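/- A cardinal κ is supercompact if and only if V_κ satisfies the following reflection principle: for every λ > κ, every formula φ of the two-sorted first-order language, and all parameters from V_κ and V_λ such that φ holds in the two-sorted structure (V_κ, V_λ), there exist an ordinal α < κ and a set N of cardinality less than ℶ_κ containing all the parameters, such that φ holds in the two-sorted structure (V_α, N) and the transitive collapse of N is equal to V_β for some β > α (the collapsing map not being required to be injective). -/

import Mathlib

universe u

/-- Formulas of the first-order language of set theory (one binary relation `∈`),
with named variables. -/
inductive FOF : Type
  | eq (i j : ℕ)
  | mem (i j : ℕ)
  | not (φ : FOF)
  | and (φ ψ : FOF)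
  | or (φ ψ : FOF)
  | all (i : ℕ) (φ : FOF)
  | ex (i : ℕ) (φ : FOF)

/-- Satisfaction of a first-order formula in the structure with universe the elements of
`M` satisfying `D`, with membership interpreted by `E` (so `FOF.Eval E D φ ρ` is the
relativization of `φ` to `D`). -/
def FOF.Eval {M : Type*} (E : M → M → Prop) (D : M → Prop) : FOF → (ℕ → M) → Prop
  | .eq i j, ρ => ρ i = ρ j
  | .mem i j, ρ => E (ρ i) (ρ j)
  | .not φ, ρ => ¬ FOF.Eval E D φ ρ
  | .and φ ψ, ρ => FOF.Eval E D φ ρ ∧ FOF.Eval E D ψ ρ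
  | .or φ ψ, ρ => FOF.Eval E D φ ρ ∨ FOF.Eval E D ψ ρ
  | .all i φ, ρ => ∀ x, D x → FOF.Eval E D φ (Function.update ρ i x)
  | .ex i φ, ρ => ∃ x, D x ∧ FOF.Eval E D φ (Function.update ρ i x)

/-- The free variables of a first-order formula. -/
def FOF.free : FOF → Set ℕ
  | .eq i j => {i, j}
  | .mem i j => {i, j}
  | .not φ => φ.free
  | .and φ ψ => φ.free ∪ ψ.free
  | .or φ ψ => φ.free ∪ ψ.free
  | .all i φ => φ.free \ {i}
  | .ex i φ => φ.free \ {i}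

/-- `V_α` as a collection of `ZFSet`s. -/
def Vset (α : Ordinal) : Set ZFSet := {x | x.rank < α}

/-- `f` is (as a `ZFSet` of Kuratowski pairs) a function with domain `d`. -/
def ZFIsFuncOn (f d : ZFSet) : Prop :=
  (∀ p ∈ f, ∃ a b, a ∈ d ∧ p = ZFSet.pair a b) ∧ (∀ a ∈ d, ∃! b, ZFSet.pair a b ∈ f)

/-- `κ` is `λ`-supercompact: there is an elementary embedding `j : V → M` into a
transitive class `M`, with critical point `κ`, `j(κ) > λ`, and `M` closed under
`λ`-sequences. -/
def LambdaSupercompact (κ lam : Ordinal) : Prop :=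
  ∃ (Mc : Set ZFSet) (j : ZFSet → ZFSet),
    (∀ x ∈ Mc, ∀ y, y ∈ x → y ∈ Mc) ∧
    (∀ x, j x ∈ Mc) ∧
    (∀ (φ : FOF) (ρ : ℕ → ZFSet),
      FOF.Eval (· ∈ ·) (fun _ => True) φ ρ ↔
        FOF.Eval (· ∈ ·) (· ∈ Mc) φ (fun i => j (ρ i))) ∧
    (∀ x : ZFSet, x.IsOrdinal → x.rank < κ → j x = x) ∧
    (∀ x : ZFSet, x.IsOrdinal → x.rank = κ → (j x).IsOrdinal ∧ lam < (j x).rank) ∧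
    (∀ d f : ZFSet, d.IsOrdinal → d.rank = lam → ZFIsFuncOn f d →
      (∀ a b, a ∈ d → ZFSet.pair a b ∈ f → b ∈ Mc) → f ∈ Mc)

/-- `κ` is supercompact: `λ`-supercompact for every `λ ≥ κ`. -/
def Supercompact (κ : Ordinal) : Prop := ∀ lam, κ ≤ lam → LambdaSupercompact κ lam

/-- Formulas of the two-sorted first-order language with membership as the sole relation;
a variable is a pair `(b, i)` where the boolean `b` chooses the sort (`false` for the
first sort, `true` for the second). -/
inductive TS : Type
  | mem (a b : Bool × ℕ)
  | eq (a b : Bool × ℕ)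
  | not (φ : TS)
  | and (φ ψ : TS)
  | or (φ ψ : TS)
  | all (v : Bool × ℕ) (φ : TS)
  | ex (v : Bool × ℕ) (φ : TS)

/-- Satisfaction in the two-sorted structure whose sorts are interpreted by `D0`, `D1`,
with membership as the sole relation. -/
def TS.Eval (D0 D1 : Set ZFSet) : TS → (Bool × ℕ → ZFSet) → Prop
  | .mem a b, ρ => ρ a ∈ ρ b
  | .eq a b, ρ => ρ a = ρ b
  | .not φ, ρ => ¬ TS.Eval D0 D1 φ ρ
  | .and φ ψ, ρ => TS.Eval D0 D1 φ ρ ∧ TS.Eval D0 D1 ψ ρ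
  | .or φ ψ, ρ => TS.Eval D0 D1 φ ρ ∨ TS.Eval D0 D1 ψ ρ
  | .all v φ, ρ => ∀ x ∈ (if v.1 then D1 else D0), TS.Eval D0 D1 φ (Function.update ρ v x)
  | .ex v φ, ρ => ∃ x ∈ (if v.1 then D1 else D0), TS.Eval D0 D1 φ (Function.update ρ v x)

/-- Free variables of a two-sorted formula. -/
def TS.free : TS → Set (Bool × ℕ)
  | .mem a b => {a, b}
  | .eq a b => {a, b}
  | .not φ => φ.free
  | .and φ ψ => φ.free ∪ ψ.free
  | .or φ ψ => φ.free ∪ ψ.free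
  | .all v φ => φ.free \ {v}
  | .ex v φ => φ.free \ {v}

/-- The reflection principle satisfied by `V_κ`: for every `λ > κ`, every formula of the
two-sorted first-order language true in `(V_κ, V_λ)` at parameters from `V_κ` and `V_λ`
reflects to a structure `(V_α, N)` with `α < κ`, `N` of cardinality `< ℶ_κ` containing
the second-sort parameters (the first-sort parameters lying in `V_α`), such that the
transitive collapse of `N` equals `V_β` for some `β > α` (the collapsing map `π` being
defined recursively by `π(x) = {π(y) : y ∈ x ∩ N}`, and not required to be injective). -/
def TwoSortedReflection (κ : Ordinal) : Prop :=
  ∀ lam : Ordinal, κ < lam →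
    ∀ φ : TS, ∀ ρ : Bool × ℕ → ZFSet,
      (∀ v ∈ φ.free, ρ v ∈ (if v.1 then Vset lam else Vset κ)) →
      TS.Eval (Vset κ) (Vset lam) φ ρ →
      ∃ α : Ordinal, α < κ ∧ ∃ N : Set ZFSet,
        Cardinal.mk ↥N < Cardinal.lift.{1,0} (Cardinal.beth κ) ∧
        (∀ v ∈ φ.free, v.1 = false → ρ v ∈ Vset α) ∧
        (∀ v ∈ φ.free, v.1 = true → ρ v ∈ N) ∧
        TS.Eval (Vset α) N φ ρ ∧
        ∃ π : ZFSet → ZFSet,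
          (∀ x ∈ N, ∀ z, z ∈ π x ↔ ∃ y ∈ N, y ∈ x ∧ π y = z) ∧
          ∃ β : Ordinal, α < β ∧ π '' N = Vset β

/-- Implication, as an abbreviation. -/
def FOF.imp (φ ψ : FOF) : FOF := .or (.not φ) ψ

/-- Equivalence, as an abbreviation. -/
def FOF.iff (φ ψ : FOF) : FOF := .and (.imp φ ψ) (.imp ψ φ)

/-- Bounded existential quantifier `∃ i ∈ k, φ`. -/
def FOF.bex (i k : ℕ) (φ : FOF) : FOF := .ex i (.and (.mem i k) φ)

/-- Bounded universal quantifier `∀ i ∈ k, φ`. -/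
def FOF.ball (i k : ℕ) (φ : FOF) : FOF := .all i (.imp (.mem i k) φ)

section Eval

variable {D : ZFSet → Prop} {ρ : ℕ → ZFSet}

@[simp] theorem FOF.eval_imp {φ ψ : FOF} :
    FOF.Eval (· ∈ ·) D (.imp φ ψ) ρ ↔ (FOF.Eval (· ∈ ·) D φ ρ → FOF.Eval (· ∈ ·) D ψ ρ) := by
  simp only [FOF.imp, FOF.Eval]; tauto

@[simp] theorem FOF.eval_iff {φ ψ : FOF} :
    FOF.Eval (· ∈ ·) D (.iff φ ψ) ρ ↔ (FOF.Eval (· ∈ ·) D φ ρ ↔ FOF.Eval (· ∈ ·) D ψ ρ) := by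
  simp only [FOF.iff, FOF.Eval, FOF.eval_imp]; tauto

theorem FOF.eval_bex {i k : ℕ} {φ : FOF} (hD : ∀ x, D x → ∀ y ∈ x, D y) (hk : D (ρ k))
    (hik : k ≠ i) : FOF.Eval (· ∈ ·) D (.bex i k φ) ρ ↔
      ∃ x ∈ ρ k, FOF.Eval (· ∈ ·) D φ (Function.update ρ i x) := by
  simp only [FOF.bex, FOF.Eval, Function.update_self, Function.update_of_ne hik]
  exact ⟨fun ⟨x, _, h⟩ => ⟨x, h⟩, fun ⟨x, h⟩ => ⟨x, hD _ hk _ h.1, h⟩⟩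

theorem FOF.eval_ball {i k : ℕ} {φ : FOF} (hD : ∀ x, D x → ∀ y ∈ x, D y) (hk : D (ρ k))
    (hik : k ≠ i) : FOF.Eval (· ∈ ·) D (.ball i k φ) ρ ↔
      ∀ x ∈ ρ k, FOF.Eval (· ∈ ·) D φ (Function.update ρ i x) := by
  simp only [FOF.ball, FOF.Eval, FOF.eval_imp, Function.update_self, Function.update_of_ne hik]
  exact ⟨fun h x hx => h x (hD _ hk _ hx) hx, fun h x _ hx => h x hx⟩

/-- `p` is the ordered pair of `x` and `y`; the variables `s` and `z` are auxiliary. -/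
def FOF.pairF (p x y s z : ℕ) : FOF :=
  .and (.bex s p (.and (.mem x s) (.ball z s (.eq z x))))
  (.and (.bex s p (.and (.mem x s) (.and (.mem y s) (.ball z s (.or (.eq z x) (.eq z y))))))
    (.ball s p (.or (.and (.mem x s) (.ball z s (.eq z x)))
      (.and (.mem x s) (.and (.mem y s) (.ball z s (.or (.eq z x) (.eq z y))))))))

theorem ZFSet.eq_pair_iff {p x y : ZFSet} : p = ZFSet.pair x y ↔
    (∃ s ∈ p, x ∈ s ∧ ∀ z ∈ s, z = x) ∧ (∃ s ∈ p, x ∈ s ∧ y ∈ s ∧ ∀ z ∈ s, z = x ∨ z = y) ∧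
      ∀ s ∈ p, (x ∈ s ∧ ∀ z ∈ s, z = x) ∨ (x ∈ s ∧ y ∈ s ∧ ∀ z ∈ s, z = x ∨ z = y) := by
  have h1 : ∀ s : ZFSet, (x ∈ s ∧ ∀ z ∈ s, z = x) ↔ s = {x} := by
    intro s
    constructor
    · rintro ⟨h, h'⟩; ext z; rw [ZFSet.mem_singleton]
      exact ⟨h' z, fun e => e ▸ h⟩
    · rintro rfl; simp
  have h2 : ∀ s : ZFSet, (x ∈ s ∧ y ∈ s ∧ ∀ z ∈ s, z = x ∨ z = y) ↔ s = {x, y} := by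
    intro s
    constructor
    · rintro ⟨h, h', h''⟩; ext z; rw [ZFSet.mem_pair]
      refine ⟨h'' z, ?_⟩
      rintro (rfl | rfl) <;> assumption
    · rintro rfl; simp
  simp only [h1, h2, exists_eq_right, ZFSet.pair]
  constructor
  · rintro rfl; simp
  · rintro ⟨h, h', h''⟩; ext z; rw [ZFSet.mem_pair]
    refine ⟨h'' z, ?_⟩
    rintro (rfl | rfl) <;> assumption

theorem FOF.eval_pairF {p x y s z : ℕ} (hD : ∀ x, D x → ∀ y ∈ x, D y) (hp : D (ρ p))
    (hsz : s ≠ z) (hps : p ≠ s) (hxs : x ≠ s) (hys : y ≠ s) (hxz : x ≠ z) (hyz : y ≠ z) :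
    FOF.Eval (· ∈ ·) D (.pairF p x y s z) ρ ↔ ρ p = ZFSet.pair (ρ x) (ρ y) := by
  rw [ZFSet.eq_pair_iff, FOF.pairF]
  simp only [FOF.Eval, FOF.eval_bex hD hp hps, FOF.eval_ball hD hp hps]
  have key : ∀ t ∈ ρ p, ∀ ψ, FOF.Eval (· ∈ ·) D (.ball z s ψ) (Function.update ρ s t) ↔
      ∀ u ∈ t, FOF.Eval (· ∈ ·) D ψ (Function.update (Function.update ρ s t) z u) := by
    intro t ht ψ
    rw [FOF.eval_ball hD (by simpa using hD _ hp _ ht) hsz, Function.update_self]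
  refine and_congr ?_ (and_congr ?_ ?_)
  · refine exists_congr fun t => and_congr_right fun ht => ?_
    simp only [key t ht, FOF.Eval, Function.update_self, Function.update_of_ne hxs,
      Function.update_of_ne hxz]
  · refine exists_congr fun t => and_congr_right fun ht => ?_
    simp only [key t ht, FOF.Eval, Function.update_self, Function.update_of_ne hxs,
      Function.update_of_ne hys, Function.update_of_ne hxz, Function.update_of_ne hyz]
  · refine forall₂_congr fun t ht => ?_
    simp only [key t ht, FOF.Eval, Function.update_self, Function.update_of_ne hxs,
      Function.update_of_ne hys, Function.update_of_ne hxz, Function.update_of_ne hyz]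

/-- `x` is an ordinal; the variables `y`, `z` and `w` are auxiliary. -/
def FOF.ordF (x y z w : ℕ) : FOF :=
  .and (.ball y x (.ball z y (.mem z x))) (.ball y x (.ball z y (.ball w z (.mem w y))))

theorem FOF.eval_ordF {x y z w : ℕ} (hD : ∀ x, D x → ∀ y ∈ x, D y) (hx : D (ρ x))
    (hxy : x ≠ y) (hxz : x ≠ z) (hyz : y ≠ z) (hyw : y ≠ w) (hzw : z ≠ w) :
    FOF.Eval (· ∈ ·) D (.ordF x y z w) ρ ↔ (ρ x).IsOrdinal := by
  rw [ZFSet.isOrdinal_iff_forall_mem_isTransitive, FOF.ordF]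
  simp only [FOF.Eval, FOF.eval_ball hD hx hxy]
  refine and_congr ?_ ?_
  · refine forall₂_congr fun a ha => ?_
    rw [FOF.eval_ball hD (by simpa using hD _ hx _ ha) hyz]
    simp [FOF.Eval, Function.update_of_ne hxz, Function.update_of_ne hxy, ZFSet.subset_def]
  · refine forall₂_congr fun a ha => ?_
    have hDa := hD _ hx _ ha
    rw [FOF.eval_ball hD (by simpa using hDa) hyz]
    simp only [Function.update_self]
    refine forall₂_congr fun b hb => ?_
    rw [FOF.eval_ball hD (by simpa using hD _ hDa _ hb) hzw]
    simp [FOF.Eval, Function.update_of_ne hyz, Function.update_of_ne hyw, ZFSet.subset_def]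

/-- The relativization to `D` of "`x` is a level of the cumulative hierarchy". -/
def IsLevelIn (D : ZFSet → Prop) (x : ZFSet) : Prop :=
  ∃ h, D h ∧ (∀ y, D y → (y ∈ x ↔ ∃ v ∈ h, y ⊆ v)) ∧
    ∀ v ∈ h, ∀ y, D y → (y ∈ v ↔ ∃ w ∈ h, w ∈ v ∧ y ⊆ w)

/-- `x` is a level of the cumulative hierarchy; the variables `5, …, 9` are auxiliary. -/
def FOF.levelF (x : ℕ) : FOF :=
  .ex 5 (.and (.all 6 (.iff (.mem 6 x) (.bex 7 5 (.ball 9 6 (.mem 9 7)))))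
    (.ball 7 5 (.all 6 (.iff (.mem 6 7) (.bex 8 5 (.and (.mem 8 7) (.ball 9 6 (.mem 9 8))))))))

theorem FOF.eval_levelF {x : ℕ} (hD : ∀ x, D x → ∀ y ∈ x, D y) (hx : x < 5) :
    FOF.Eval (· ∈ ·) D (.levelF x) ρ ↔ IsLevelIn D (ρ x) := by
  have hx5 : x ≠ 5 := by omega
  have hx6 : x ≠ 6 := by omega
  rw [FOF.levelF, IsLevelIn, FOF.Eval]
  refine exists_congr fun h => and_congr_right fun hh => ?_
  rw [FOF.Eval, FOF.eval_ball hD (by simpa using hh) (by decide)]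
  refine and_congr ?_ ?_
  · rw [FOF.Eval]
    refine forall₂_congr fun y hy => ?_
    rw [FOF.eval_iff, FOF.eval_bex hD (by simpa using hh) (by decide)]
    refine iff_congr (by simp [FOF.Eval, hx6, hx5]) ?_
    simp only [Function.update_self, ne_eq, Nat.reduceEqDiff,
      not_false_eq_true, Function.update_of_ne]
    refine exists_congr fun v => and_congr_right fun hv => ?_
    rw [FOF.eval_ball hD (by simpa using hy) (by decide)]
    simp [FOF.Eval, ZFSet.subset_def]
  · simp only [Function.update_self]
    refine forall₂_congr fun v hv => ?_
    rw [FOF.Eval]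
    refine forall₂_congr fun y hy => ?_
    rw [FOF.eval_iff, FOF.eval_bex hD (by simpa using hh) (by decide)]
    refine iff_congr (by simp [FOF.Eval]) ?_
    simp only [Function.update_self, ne_eq, Nat.reduceEqDiff,
      not_false_eq_true, Function.update_of_ne]
    refine exists_congr fun w => and_congr_right fun hw => ?_
    rw [FOF.Eval, FOF.eval_ball hD (by simpa using hy) (by decide)]
    simp [FOF.Eval, ZFSet.subset_def]

end Eval

theorem exists_mem_iff_lt_of_isLowerSet {S : Set Ordinal} (hS : IsLowerSet S)
    (hb : BddAbove S) : ∃ γ, ∀ o, o ∈ S ↔ o < γ := by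
  obtain ⟨b, hb⟩ := hb
  have hne : Sᶜ.Nonempty := ⟨Order.succ b, fun h => (Order.lt_succ b).not_ge (hb h)⟩
  refine ⟨sInf Sᶜ, fun o => ⟨fun h => ?_, fun h => ?_⟩⟩
  · by_contra! hle
    exact csInf_mem hne (hS hle h)
  · by_contra hn
    exact (csInf_le' hn).not_gt h

theorem IsLevelIn.exists_rank {D : ZFSet → Prop} (hD : ∀ x, D x → ∀ y ∈ x, D y) {x : ZFSet}
    (hx : D x) (h : IsLevelIn D x) : ∃ γ, ∀ y, y ∈ x ↔ D y ∧ y.rank < γ := by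
  obtain ⟨h, hh, h1, h2⟩ := h
  have step : ∀ (P : ZFSet → Prop) (v : ZFSet), D v →
      (∀ w ∈ h, P w → ∃ γ, ∀ y, y ∈ w ↔ D y ∧ y.rank < γ) →
      (∀ y, D y → (y ∈ v ↔ ∃ w ∈ h, P w ∧ y ⊆ w)) → ∃ γ, ∀ y, y ∈ v ↔ D y ∧ y.rank < γ := by
    intro P v hv ih hy
    choose! g hg using ih
    obtain ⟨γ, hγ⟩ := exists_mem_iff_lt_of_isLowerSet
      (S := {o | ∃ w : h, P w.1 ∧ o ≤ g w.1})
      (fun a b hab ⟨w, hw, hb⟩ => ⟨w, hw, hab.trans hb⟩)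
      ⟨⨆ w : h, g w.1, fun o ⟨w, _, hw⟩ => hw.trans
        (le_ciSup (f := fun w : h => g w.1) (Ordinal.bddAbove_of_small) w)⟩
    refine ⟨γ, fun y => ?_⟩
    rw [← hγ]
    have : ∀ y, D y → (y ∈ v ↔ ∃ w : h, P w.1 ∧ y.rank ≤ g w.1) := by
      intro y hyD
      rw [hy y hyD]
      constructor
      · rintro ⟨w, hw, hPw, hyw⟩
        refine ⟨⟨w, hw⟩, hPw, ZFSet.rank_le_iff.2 fun z hz => ?_⟩
        exact ((hg w hw hPw z).1 (hyw hz)).2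
      · rintro ⟨⟨w, hw⟩, hPw, hyw⟩
        exact ⟨w, hw, hPw, fun z hz => (hg w hw hPw z).2
          ⟨hD _ hyD _ hz, (ZFSet.rank_lt_of_mem hz).trans_le hyw⟩⟩
    exact ⟨fun hyv => ⟨hD _ hv _ hyv, (this y (hD _ hv _ hyv)).1 hyv⟩,
      fun hh => (this y hh.1).2 hh.2⟩
  have hmem : ∀ v, v ∈ h → ∃ γ, ∀ y, y ∈ v ↔ D y ∧ y.rank < γ := by
    intro v
    induction v using ZFSet.inductionOn with
    | h v ih =>
      intro hv
      exact step (· ∈ v) v (hD _ hh _ hv) (fun w hw hwv => ih w hwv hw) (h2 v hv)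
  exact step (fun _ => True) x hx (fun w hw _ => hmem w hw) (by simpa using h1)

open ZFSet in
theorem isLevelIn_vonNeumann {D : ZFSet → Prop} {α : Ordinal}
    (hh : D ((V_ α).sep fun v => ∃ β, v = V_ β)) : IsLevelIn D (V_ α) := by
  refine ⟨_, hh, fun y _ => ?_, fun v hv y _ => ?_⟩
  · rw [mem_vonNeumann']
    constructor
    · rintro ⟨a, ha, hy⟩
      exact ⟨V_ a, by simp [ha], hy⟩
    · rintro ⟨v, hv, hy⟩
      obtain ⟨hv, β, rfl⟩ := mem_sep.1 hv
      exact ⟨β, by simpa using hv, hy⟩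
  · obtain ⟨hv, β, rfl⟩ := mem_sep.1 hv
    rw [mem_vonNeumann']
    rw [vonNeumann_mem_vonNeumann_iff] at hv
    constructor
    · rintro ⟨a, ha, hy⟩
      exact ⟨V_ a, by simp [ha.trans hv], by simpa using ha, hy⟩
    · rintro ⟨w, hw, hw', hy⟩
      obtain ⟨hw, γ, rfl⟩ := mem_sep.1 hw
      exact ⟨γ, by simpa using hw', hy⟩

/-- `j` is an elementary embedding of the universe into the transitive class `Mc`. -/
structure IsElemEmb (Mc : Set ZFSet.{u}) (j : ZFSet.{u} → ZFSet.{u}) : Prop where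
  trans : ∀ x ∈ Mc, ∀ y ∈ x, y ∈ Mc
  map_mem : ∀ x, j x ∈ Mc
  elem : ∀ (φ : FOF) (ρ : ℕ → ZFSet), FOF.Eval (· ∈ ·) (fun _ => True) φ ρ ↔
    FOF.Eval (· ∈ ·) (· ∈ Mc) φ (fun i => j (ρ i))

/-- `Mc` is closed under sequences of length `lam`. -/
def IsClosedUnderSeq (Mc : Set ZFSet) (lam : Ordinal) : Prop :=
  ∀ d f : ZFSet, d.IsOrdinal → d.rank = lam → ZFIsFuncOn f d →
    (∀ a b, a ∈ d → ZFSet.pair a b ∈ f → b ∈ Mc) → f ∈ Mc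

/-- The assignment listing `x` and then `y` forever. -/
def assign₂ (x y : ZFSet) (i : ℕ) : ZFSet := if i = 0 then x else y

namespace IsElemEmb

variable {Mc : Set ZFSet.{u}} {j : ZFSet.{u} → ZFSet.{u}}

theorem mem_iff (hj : IsElemEmb Mc j) {x y : ZFSet} : j x ∈ j y ↔ x ∈ y := by
  simpa [FOF.Eval, assign₂] using (hj.elem (.mem 0 1) (assign₂ x y)).symm

theorem inj_iff (hj : IsElemEmb Mc j) {x y : ZFSet} : j x = j y ↔ x = y := by
  simpa [FOF.Eval, assign₂] using (hj.elem (.eq 0 1) (assign₂ x y)).symm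

theorem map_subset (hj : IsElemEmb Mc j) {x y : ZFSet} (h : x ⊆ y) : j x ⊆ j y := by
  have := (hj.elem (.all 2 (.imp (.mem 2 0) (.mem 2 1))) (assign₂ x y)).1
    (by simpa [FOF.Eval, assign₂, ZFSet.subset_def] using h)
  simp only [FOF.Eval, FOF.eval_imp, assign₂] at this
  intro z hz
  simpa using this z (hj.trans _ (hj.map_mem x) _ hz) (by simpa using hz)

theorem isOrdinal (hj : IsElemEmb Mc j) {x : ZFSet} (h : x.IsOrdinal) : (j x).IsOrdinal := by
  have := (hj.elem (.ordF 0 1 2 3) (assign₂ x x)).1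
    ((FOF.eval_ordF (by simp) trivial (by decide) (by decide) (by decide) (by decide)
      (by decide)).2 h)
  exact (FOF.eval_ordF hj.trans (hj.map_mem _) (by decide) (by decide) (by decide) (by decide)
      (by decide)).1 this

theorem empty_mem (hj : IsElemEmb Mc j) : ∅ ∈ Mc := by
  have := (hj.elem (.all 1 (.not (.mem 1 0))) (assign₂ ∅ ∅)).1 (by simp [FOF.Eval, assign₂])
  simp only [FOF.Eval, assign₂] at this
  have h : j ∅ = ∅ := by
    rw [ZFSet.eq_empty]
    intro y hy
    exact this y (hj.trans _ (hj.map_mem _) _ hy) (by simpa using hy)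
  exact h ▸ hj.map_mem ∅

theorem pair_mem (hj : IsElemEmb Mc j) {x y : ZFSet} (hx : x ∈ Mc) (hy : y ∈ Mc) :
    ZFSet.pair x y ∈ Mc := by
  have := (hj.elem (.all 0 (.all 1 (.ex 2 (.pairF 2 0 1 3 4)))) (assign₂ ∅ ∅)).1 (by
    simp only [FOF.Eval]
    intro x _ y _
    exact ⟨ZFSet.pair x y, trivial, (FOF.eval_pairF (by simp) trivial (by decide) (by decide)
      (by decide) (by decide) (by decide) (by decide)).2 (by simp)⟩)
  simp only [FOF.Eval] at this
  obtain ⟨p, hp, h⟩ := this x hx y hy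
  rw [FOF.eval_pairF hj.trans (by simpa using hp) (by decide) (by decide)
      (by decide) (by decide) (by decide) (by decide)] at h
  simp only [Function.update_self, ne_eq, OfNat.zero_ne_ofNat,
      OfNat.one_ne_ofNat, not_false_eq_true, Function.update_of_ne, zero_ne_one] at h
  exact h ▸ hp

theorem exists_range (hj : IsElemEmb Mc j) {f : ZFSet} (hf : f ∈ Mc) :
    ∃ r ∈ Mc, ∀ y ∈ Mc, y ∈ r ↔ ∃ x, ZFSet.pair x y ∈ f := by
  have := (hj.elem (.all 0 (.ex 1 (.all 2 (.iff (.mem 2 1)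
      (.ex 4 (.bex 3 0 (.pairF 3 4 2 5 6))))))) (assign₂ ∅ ∅)).1 (by
    simp only [FOF.Eval, FOF.eval_iff]
    intro f _
    refine ⟨(ZFSet.sUnion (ZFSet.sUnion f)).sep fun y => ∃ x, ZFSet.pair x y ∈ f, trivial,
      fun y _ => ?_⟩
    simp only [FOF.eval_bex (D := fun _ : ZFSet => True) (by simp) trivial (by decide : 0 ≠ 3),
      FOF.eval_pairF (D := fun _ : ZFSet => True) (p := 3) (x := 4) (y := 2) (s := 5) (z := 6)
        (by simp) trivial (by decide) (by decide) (by decide) (by decide) (by decide) (by decide)]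
    simp only [Function.update_self, ne_eq, Nat.reduceEqDiff, OfNat.zero_ne_ofNat,
      OfNat.one_ne_ofNat, not_false_eq_true, Function.update_of_ne,
      zero_ne_one, exists_eq_right, true_and, ZFSet.mem_sep, and_iff_right_iff_imp,
      ZFSet.mem_sUnion]
    rintro ⟨x, hx⟩
    exact ⟨{x, y}, ⟨_, hx, by simp [ZFSet.pair]⟩, by simp⟩)
  simp only [FOF.Eval, FOF.eval_iff] at this
  obtain ⟨r, hr, h⟩ := this f hf
  refine ⟨r, hr, fun y hy => ?_⟩
  have h := h y hy
  simp only [Function.update_self, ne_eq, OfNat.one_ne_ofNat,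
      not_false_eq_true, Function.update_of_ne] at h
  rw [h]
  constructor
  · rintro ⟨x, hx, h⟩
    rw [FOF.eval_bex hj.trans (by simpa using hf) (by decide)] at h
    obtain ⟨p, hp, h⟩ := h
    have hpf : p ∈ f := by simpa using hp
    rw [FOF.eval_pairF hj.trans (by simpa using hj.trans _ hf _ hpf) (by decide) (by decide)
      (by decide) (by decide) (by decide) (by decide)] at h
    have h' : p = ZFSet.pair x y := by simpa using h
    exact ⟨x, h' ▸ hpf⟩
  · rintro ⟨x, hx⟩
    have hpM := hj.trans _ hf _ hx
    refine ⟨x, hj.trans {x} (hj.trans _ hpM _ (by simp [ZFSet.pair])) _ (by simp), ?_⟩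
    rw [FOF.eval_bex hj.trans (by simpa using hf) (by decide)]
    refine ⟨ZFSet.pair x y, by simpa using hx, ?_⟩
    rw [FOF.eval_pairF hj.trans (by simpa using hpM) (by decide) (by decide)
      (by decide) (by decide) (by decide) (by decide)]
    simp

theorem mem_of_subset (hj : IsElemEmb Mc j) {lam : Ordinal} (hc : IsClosedUnderSeq Mc lam)
    {A : ZFSet} (hA : ∀ x ∈ A, x ∈ Mc) (hcard : A.card ≤ lam.card) : A ∈ Mc := by
  obtain rfl | hne := A.eq_empty_or_nonempty
  · exact hj.empty_mem
  have : Nonempty A := hne.to_subtype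
  rw [← Ordinal.card_toZFSet] at hcard
  obtain ⟨e⟩ := hcard
  obtain ⟨g, hg⟩ : ∃ g : lam.toZFSet → A, Function.Surjective g := by
    let e' : A ↪ lam.toZFSet := (equivShrink A).toEmbedding.trans
      (e.trans (equivShrink lam.toZFSet).symm.toEmbedding)
    exact ⟨Function.invFun e', Function.invFun_surjective e'.injective⟩
  let f : ZFSet := ZFSet.range fun x : lam.toZFSet => ZFSet.pair x.1 (g x).1
  have hf : f ∈ Mc := by
    refine hc lam.toZFSet f (ZFSet.isOrdinal_toZFSet _) (by simp) ⟨?_, ?_⟩ ?_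
    · intro p hp
      obtain ⟨x, rfl⟩ := ZFSet.mem_range.1 hp
      exact ⟨x, _, x.2, rfl⟩
    · intro a ha
      refine ⟨(g ⟨a, ha⟩).1, ZFSet.mem_range.2 ⟨⟨a, ha⟩, rfl⟩, fun b hb => ?_⟩
      obtain ⟨x, hx⟩ := ZFSet.mem_range.1 hb
      obtain ⟨rfl, rfl⟩ := ZFSet.pair_inj.1 hx
      rfl
    · intro a b _ hb
      obtain ⟨x, hx⟩ := ZFSet.mem_range.1 hb
      obtain ⟨rfl, rfl⟩ := ZFSet.pair_inj.1 hx
      exact hA _ (g x).2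
  obtain ⟨r, hr, h⟩ := hj.exists_range hf
  convert hr
  ext y
  constructor
  · intro hy
    obtain ⟨x, hx⟩ := hg ⟨y, hy⟩
    exact (h y (hA y hy)).2 ⟨x, ZFSet.mem_range.2 ⟨x, by rw [hx]⟩⟩
  · intro hy
    obtain ⟨x, hx⟩ := (h y (hj.trans _ hr _ hy)).1 hy
    obtain ⟨x, hx⟩ := ZFSet.mem_range.1 hx
    obtain ⟨-, rfl⟩ := ZFSet.pair_inj.1 hx
    exact (g x).2

open ZFSet in
theorem mem_map_vonNeumann (hj : IsElemEmb Mc j) {α : Ordinal} {y : ZFSet} :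
    y ∈ j (V_ α) ↔ y ∈ Mc ∧ y.rank < (j α.toZFSet).rank := by
  have hlev : IsLevelIn (· ∈ Mc) (j (V_ α)) :=
    (FOF.eval_levelF (x := 0) hj.trans (by decide)).1 <|
      (hj.elem (.levelF 0) (assign₂ (V_ α) (V_ α))).1 <|
        (FOF.eval_levelF (by simp) (by decide)).2 (isLevelIn_vonNeumann trivial)
  obtain ⟨γ, hγ⟩ := hlev.exists_rank hj.trans (hj.map_mem _)
  have hord : ∀ z ∈ Mc, z.IsOrdinal → (z ∈ j (V_ α) ↔ z ∈ j α.toZFSet) := by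
    have := (hj.elem (.all 2 (.imp (.ordF 2 3 4 5) (.iff (.mem 2 0) (.mem 2 1))))
        (assign₂ (V_ α) α.toZFSet)).1 (by
      simp only [FOF.Eval, FOF.eval_imp, FOF.eval_iff]
      intro z _ hz
      rw [FOF.eval_ordF (by simp) trivial (by decide) (by decide) (by decide) (by decide)
        (by decide)] at hz
      simp only [Function.update_self] at hz
      simp only [assign₂, Function.update_self, ne_eq, OfNat.zero_ne_ofNat, OfNat.one_ne_ofNat,
        not_false_eq_true, Function.update_of_ne, if_true, one_ne_zero, if_false,
        mem_vonNeumann]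
      rw [hz.rank_lt_iff_mem (ZFSet.isOrdinal_toZFSet α) |>.symm, Ordinal.rank_toZFSet])
    simp only [FOF.Eval, FOF.eval_imp, FOF.eval_iff] at this
    intro z hz hzo
    simpa [assign₂] using this z hz ((FOF.eval_ordF hj.trans (by simpa using hz) (by decide)
      (by decide) (by decide) (by decide) (by decide)).2 (by simpa using hzo))
  have ho := hj.isOrdinal (ZFSet.isOrdinal_toZFSet α)
  have : γ = (j α.toZFSet).rank := by
    refine le_antisymm ?_ ?_
    · by_contra! hlt
      exact mem_irrefl _ ((hord _ (hj.map_mem _) ho).1 ((hγ _).2 ⟨hj.map_mem _, hlt⟩))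
    · rw [rank_le_iff]
      intro y hy
      have hyM := hj.trans _ (hj.map_mem _) _ hy
      exact ((hγ _).1 ((hord y hyM (ho.mem hy)).2 hy)).2
  rw [hγ, this]

open ZFSet in
theorem map_eq_self (hj : IsElemEmb Mc j) {κ : Ordinal}
    (hκ : ∀ x : ZFSet, x.IsOrdinal → x.rank < κ → j x = x) {x : ZFSet} (hx : x.rank < κ) :
    j x = x := by
  induction h : x.rank using WellFoundedLT.induction generalizing x with
  | ind o ih =>
    subst h
    ext y
    constructor
    · intro hy
      have h1 := hj.map_subset (subset_vonNeumann_self x) hy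
      rw [hj.mem_map_vonNeumann, hκ _ (ZFSet.isOrdinal_toZFSet _) (by simpa using hx),
        Ordinal.rank_toZFSet] at h1
      have := ih _ h1.2 (h1.2.trans hx) rfl
      rw [← this] at hy
      exact hj.mem_iff.1 hy
    · intro hy
      have hr := rank_lt_of_mem hy
      have := ih _ hr (hr.trans hx) rfl
      rw [← this]
      exact hj.mem_iff.2 hy

end IsElemEmb

/-- The pair of `x` and `y` belongs to `g`; the variables `q`, `s` and `z` are auxiliary. -/
def FOF.pairMemF (x y g q s z : ℕ) : FOF := .bex q g (.pairF q x y s z)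

theorem FOF.eval_pairMemF {D : ZFSet → Prop} {ρ : ℕ → ZFSet} {x y g q s z : ℕ}
    (hD : ∀ x, D x → ∀ y ∈ x, D y) (hg : D (ρ g)) (hgq : g ≠ q) (hqs : q ≠ s)
    (hxq : x ≠ q) (hyq : y ≠ q) (hsz : s ≠ z) (hxs : x ≠ s) (hys : y ≠ s) (hxz : x ≠ z)
    (hyz : y ≠ z) :
    FOF.Eval (· ∈ ·) D (.pairMemF x y g q s z) ρ ↔ ZFSet.pair (ρ x) (ρ y) ∈ ρ g := by
  rw [FOF.pairMemF, FOF.eval_bex hD hg hgq]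
  constructor
  · rintro ⟨p, hp, h⟩
    rw [FOF.eval_pairF hD (by simpa using hD _ hg _ hp) hsz hqs hxs hys hxz hyz] at h
    simp only [Function.update_self, Function.update_of_ne hxq, Function.update_of_ne hyq] at h
    exact h ▸ hp
  · intro h
    refine ⟨_, h, ?_⟩
    rw [FOF.eval_pairF hD (by simpa using hD _ hg _ h) hsz hqs hxs hys hxz hyz]
    simp [hxq, hyq]

/-- `g` is the graph of an isomorphism between the `∈`-structures on `b` and `n`. -/
structure IsMemIso (b n g : ZFSet) : Prop where
  left : ∀ x ∈ b, ∃ y ∈ n, ZFSet.pair x y ∈ g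
  right : ∀ y ∈ n, ∃ x ∈ b, ZFSet.pair x y ∈ g
  mem_iff : ∀ x ∈ b, ∀ y ∈ n, ∀ x₂ ∈ b, ∀ y₂ ∈ n, ZFSet.pair x y ∈ g → ZFSet.pair x₂ y₂ ∈ g →
    (x ∈ x₂ ↔ y ∈ y₂)
  inj_iff : ∀ x ∈ b, ∀ y ∈ n, ∀ x₂ ∈ b, ∀ y₂ ∈ n, ZFSet.pair x y ∈ g → ZFSet.pair x₂ y₂ ∈ g →
    (x = x₂ ↔ y = y₂)

/-- The variables `2`, `3`, `4` are related by `IsMemIso`; the variables `5, …, 11` are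
auxiliary. -/
def FOF.isoF : FOF :=
  .and (.ball 5 2 (.bex 6 3 (.pairMemF 5 6 4 7 8 9)))
  (.and (.ball 6 3 (.bex 5 2 (.pairMemF 5 6 4 7 8 9)))
  (.ball 5 2 (.ball 6 3 (.ball 10 2 (.ball 11 3 (.imp (.pairMemF 5 6 4 7 8 9)
    (.imp (.pairMemF 10 11 4 7 8 9)
      (.and (.iff (.mem 5 10) (.mem 6 11)) (.iff (.eq 5 10) (.eq 6 11))))))))))

theorem FOF.eval_isoF {D : ZFSet → Prop} {ρ : ℕ → ZFSet} (hD : ∀ x, D x → ∀ y ∈ x, D y)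
    (h2 : D (ρ 2)) (h3 : D (ρ 3)) (h4 : D (ρ 4)) :
    FOF.Eval (· ∈ ·) D .isoF ρ ↔ IsMemIso (ρ 2) (ρ 3) (ρ 4) := by
  have e1 : FOF.Eval (· ∈ ·) D (.ball 5 2 (.bex 6 3 (.pairMemF 5 6 4 7 8 9))) ρ ↔
      ∀ x ∈ ρ 2, ∃ y ∈ ρ 3, ZFSet.pair x y ∈ ρ 4 := by
    rw [FOF.eval_ball hD h2 (by decide)]
    refine forall₂_congr fun x hx => ?_
    rw [FOF.eval_bex hD (by simpa using h3) (by decide)]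
    refine exists_congr fun y => and_congr (by simp) ?_
    rw [FOF.eval_pairMemF hD (by simpa using h4)] <;> simp
  have e2 : FOF.Eval (· ∈ ·) D (.ball 6 3 (.bex 5 2 (.pairMemF 5 6 4 7 8 9))) ρ ↔
      ∀ y ∈ ρ 3, ∃ x ∈ ρ 2, ZFSet.pair x y ∈ ρ 4 := by
    rw [FOF.eval_ball hD h3 (by decide)]
    refine forall₂_congr fun x hx => ?_
    rw [FOF.eval_bex hD (by simpa using h2) (by decide)]
    refine exists_congr fun y => and_congr (by simp) ?_
    rw [FOF.eval_pairMemF hD (by simpa using h4)] <;> simp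
  have e3 : FOF.Eval (· ∈ ·) D (.ball 5 2 (.ball 6 3 (.ball 10 2 (.ball 11 3
      (.imp (.pairMemF 5 6 4 7 8 9) (.imp (.pairMemF 10 11 4 7 8 9)
      (.and (.iff (.mem 5 10) (.mem 6 11)) (.iff (.eq 5 10) (.eq 6 11))))))))) ρ ↔
      ∀ x ∈ ρ 2, ∀ y ∈ ρ 3, ∀ x' ∈ ρ 2, ∀ y' ∈ ρ 3, ZFSet.pair x y ∈ ρ 4 →
        ZFSet.pair x' y' ∈ ρ 4 → (x ∈ x' ↔ y ∈ y') ∧ (x = x' ↔ y = y') := by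
    rw [FOF.eval_ball hD h2 (by decide)]
    refine forall₂_congr fun x hx => ?_
    rw [FOF.eval_ball hD (by simpa using h3) (by decide)]
    refine forall_congr' fun y => imp_congr (by simp) ?_
    rw [FOF.eval_ball hD (by simpa using h2) (by decide)]
    refine forall_congr' fun x' => imp_congr (by simp) ?_
    rw [FOF.eval_ball hD (by simpa using h3) (by decide)]
    refine forall_congr' fun y' => imp_congr (by simp) ?_
    rw [FOF.eval_imp, FOF.eval_imp, FOF.eval_pairMemF hD (by simpa using h4),
      FOF.eval_pairMemF hD (by simpa using h4)] <;> simp [FOF.Eval]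
  rw [FOF.isoF, FOF.Eval, FOF.Eval, e1, e2, e3]
  constructor
  · rintro ⟨a, b, c⟩
    exact ⟨a, b, fun x hx y hy x' hx' y' hy' h h' => (c x hx y hy x' hx' y' hy' h h').1,
      fun x hx y hy x' hx' y' hy' h h' => (c x hx y hy x' hx' y' hy' h h').2⟩
  · rintro ⟨a, b, c, d⟩
    exact ⟨a, b, fun x hx y hy x₂ hx₂ y₂ hy₂ h h₂ =>
      ⟨c x hx y hy x₂ hx₂ y₂ hy₂ h h₂, d x hx y hy x₂ hx₂ y₂ hy₂ h h₂⟩⟩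

/-- The first-order variable coding a two-sorted variable. -/
def TS.code (v : Bool × ℕ) : ℕ := 2 * v.2 + v.1.toNat + 12

/-- The two-sorted variable coded by a first-order variable. -/
def TS.decode (i : ℕ) : Bool × ℕ := (i % 2 == 1, (i - 12) / 2)

@[simp] theorem TS.decode_code (v : Bool × ℕ) : TS.decode (TS.code v) = v := by
  obtain ⟨b, n⟩ := v
  cases b <;> simp [TS.code, TS.decode]
  omega

theorem TS.code_injective : Function.Injective TS.code :=
  Function.LeftInverse.injective TS.decode_code

theorem TS.le_code (v : Bool × ℕ) : 12 ≤ TS.code v := by simp [TS.code]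

/-- The first-order translation of a two-sorted formula, the two sorts being the elements of
the variables `1` and `3`. -/
def TS.toFOF : TS → FOF
  | .mem a b => .mem (TS.code a) (TS.code b)
  | .eq a b => .eq (TS.code a) (TS.code b)
  | .not φ => .not φ.toFOF
  | .and φ ψ => .and φ.toFOF ψ.toFOF
  | .or φ ψ => .or φ.toFOF ψ.toFOF
  | .all v φ => .ball (TS.code v) (if v.1 then 3 else 1) φ.toFOF
  | .ex v φ => .bex (TS.code v) (if v.1 then 3 else 1) φ.toFOF

theorem TS.eval_toFOF {D : ZFSet → Prop} {ρ : ℕ → ZFSet} (hD : ∀ x, D x → ∀ y ∈ x, D y)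
    (h1 : D (ρ 1)) (h3 : D (ρ 3)) (φ : TS) :
    FOF.Eval (· ∈ ·) D φ.toFOF ρ ↔
      TS.Eval {x | x ∈ ρ 1} {x | x ∈ ρ 3} φ fun v => ρ (TS.code v) := by
  have hu : ∀ (ρ : ℕ → ZFSet) v x, (fun w => Function.update ρ (TS.code v) x (TS.code w)) =
      Function.update (fun w => ρ (TS.code w)) v x := fun ρ v x =>
    Function.update_comp_eq_of_injective ρ TS.code_injective v x
  have hv : ∀ (v : Bool × ℕ), (if v.1 then 3 else 1) ≠ TS.code v := by
    intro v
    have := TS.le_code v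
    split_ifs <;> omega
  have hne1 : ∀ (v : Bool × ℕ), 1 ≠ TS.code v := fun v => by have := TS.le_code v; omega
  have hne3 : ∀ (v : Bool × ℕ), 3 ≠ TS.code v := fun v => by have := TS.le_code v; omega
  induction φ generalizing ρ with
  | mem a b => rfl
  | eq a b => rfl
  | not φ ih => exact not_congr (ih h1 h3)
  | and φ ψ ih ih' => exact and_congr (ih h1 h3) (ih' h1 h3)
  | or φ ψ ih ih' => exact or_congr (ih h1 h3) (ih' h1 h3)
  | all v φ ih =>
    rw [TS.toFOF, FOF.eval_ball hD (by split_ifs <;> assumption) (hv v), TS.Eval]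
    refine forall_congr' fun x => imp_congr (by split_ifs <;> rfl) ?_
    refine (ih (by simpa [hne1] using h1) (by simpa [hne3] using h3)).trans ?_
    rw [hu, Function.update_of_ne (hne1 v), Function.update_of_ne (hne3 v)]
  | ex v φ ih =>
    rw [TS.toFOF, FOF.eval_bex hD (by split_ifs <;> assumption) (hv v), TS.Eval]
    refine exists_congr fun x => and_congr (by split_ifs <;> rfl) ?_
    refine (ih (by simpa [hne1] using h1) (by simpa [hne3] using h3)).trans ?_
    rw [hu, Function.update_of_ne (hne1 v), Function.update_of_ne (hne3 v)]

theorem TS.eval_image {j : ZFSet → ZFSet} (hmem : ∀ x y, j x ∈ j y ↔ x ∈ y)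
    (hinj : Function.Injective j) (D0 D1 : Set ZFSet) (φ : TS) (ρ : Bool × ℕ → ZFSet) :
    TS.Eval (j '' D0) (j '' D1) φ (fun v => j (ρ v)) ↔ TS.Eval D0 D1 φ ρ := by
  have hu : ∀ (ρ : Bool × ℕ → ZFSet) v x, Function.update (fun w => j (ρ w)) v (j x) =
      fun w => j (Function.update ρ v x w) := fun ρ v x =>
    (Function.comp_update j ρ v x).symm
  have hs : ∀ b : Bool, (if b then j '' D1 else j '' D0) = j '' (if b then D1 else D0) := by
    intro b; cases b <;> rfl
  induction φ generalizing ρ with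
  | mem a b => exact hmem _ _
  | eq a b => exact hinj.eq_iff
  | not φ ih => exact not_congr (ih _)
  | and φ ψ ih ih' => exact and_congr (ih _) (ih' _)
  | or φ ψ ih ih' => exact or_congr (ih _) (ih' _)
  | all v φ ih => simp only [TS.Eval, hs, Set.forall_mem_image, hu, ih]
  | ex v φ ih => simp only [TS.Eval, hs, Set.exists_mem_image, hu, ih]

theorem TS.finite_free (φ : TS) : φ.free.Finite := by
  induction φ with
  | mem a b => simp [TS.free]
  | eq a b => simp [TS.free]
  | not φ ih => exact ih
  | and φ ψ ih ih' => exact ih.union ih'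
  | or φ ψ ih ih' => exact ih.union ih'
  | all v φ ih => exact ih.sdiff
  | ex v φ ih => exact ih.sdiff

/-- The conjunction of a list of formulas. -/
def FOF.conj : List FOF → FOF
  | [] => .eq 0 0
  | φ :: l => .and φ (FOF.conj l)

theorem FOF.eval_conj {D : ZFSet → Prop} {ρ : ℕ → ZFSet} (l : List FOF) :
    FOF.Eval (· ∈ ·) D (.conj l) ρ ↔ ∀ φ ∈ l, FOF.Eval (· ∈ ·) D φ ρ := by
  induction l with
  | nil => simp [FOF.conj, FOF.Eval]
  | cons φ l ih => simp [FOF.conj, FOF.Eval, ih]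

/-- The free variables of the two-sorted formula `φ` take values in the two sorts. -/
noncomputable def TS.paramsF (φ : TS) : FOF :=
  .conj (φ.finite_free.toFinset.toList.map fun v =>
    .mem (TS.code v) (if v.1 then 3 else 1))

theorem TS.eval_paramsF {D : ZFSet → Prop} {ρ : ℕ → ZFSet} (φ : TS) :
    FOF.Eval (· ∈ ·) D φ.paramsF ρ ↔
      ∀ v ∈ φ.free, ρ (TS.code v) ∈ if v.1 then ρ 3 else ρ 1 := by
  simp only [TS.paramsF, FOF.eval_conj, List.mem_map, Finset.mem_toList, Set.Finite.mem_toFinset,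
    forall_exists_index, and_imp, forall_apply_eq_imp_iff₂, FOF.Eval, apply_ite ρ]

/-- In `D`, the set `n` is the image of a level `b ∈ p` under the `∈`-isomorphism `g`, and
`φ` holds in the two-sorted structure `(a, n)` for a level `a ∈ b`. -/
structure ReflectsIn (D : ZFSet → Prop) (φ : TS) (ρ : Bool × ℕ → ZFSet) (p a b n g : ZFSet) :
    Prop where
  level_left : IsLevelIn D a
  level_right : IsLevelIn D b
  left_mem : a ∈ b
  right_mem : b ∈ p
  iso : IsMemIso b n g
  params : ∀ v ∈ φ.free, ρ v ∈ if v.1 then n else a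
  eval : TS.Eval {x | x ∈ a} {x | x ∈ n} φ ρ

/-- The first-order formula expressing that `ReflectsIn` holds of some `a`, `b`, `n`, `g`. -/
noncomputable def TS.reflectsF (φ : TS) : FOF :=
  .ex 1 (.ex 2 (.ex 3 (.ex 4 (.and (.levelF 1) (.and (.levelF 2) (.and (.mem 1 2)
    (.and (.mem 2 0) (.and .isoF (.and φ.paramsF φ.toFOF)))))))))

theorem TS.eval_reflectsF {D : ZFSet → Prop} {ρ : ℕ → ZFSet} (hD : ∀ x, D x → ∀ y ∈ x, D y)
    (φ : TS) : FOF.Eval (· ∈ ·) D φ.reflectsF ρ ↔ ∃ a, D a ∧ ∃ b, D b ∧ ∃ n, D n ∧ ∃ g, D g ∧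
      ReflectsIn D φ (fun v => ρ (TS.code v)) (ρ 0) a b n g := by
  have hne (v : Bool × ℕ) (i : ℕ) (h : i < 12) : TS.code v ≠ i := by
    have := TS.le_code v; omega
  simp only [TS.reflectsF, FOF.Eval]
  refine exists_congr fun a => and_congr_right fun ha => exists_congr fun b =>
    and_congr_right fun hb => exists_congr fun n => and_congr_right fun hn => exists_congr fun g =>
    and_congr_right fun hg => ?_
  rw [FOF.eval_levelF hD (by decide), FOF.eval_levelF hD (by decide),
    FOF.eval_isoF hD (by simpa using hb) (by simpa using hn) (by simpa using hg),
    TS.eval_paramsF, TS.eval_toFOF hD (by simpa using ha) (by simpa using hn)]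
  simp only [ne_eq, hne _ 1 (by decide), hne _ 2 (by decide), hne _ 3 (by decide),
    hne _ 4 (by decide), not_false_eq_true, Function.update_of_ne]
  simp only [Function.update_self, ne_eq, Nat.reduceEqDiff, OfNat.one_ne_ofNat,
    OfNat.zero_ne_ofNat, zero_ne_one, not_false_eq_true, Function.update_of_ne]
  exact ⟨fun ⟨a, b, c, d, e, f, g⟩ => ⟨a, b, c, d, e, f, g⟩,
    fun ⟨a, b, c, d, e, f, g⟩ => ⟨a, b, c, d, e, f, g⟩⟩

theorem ZFSet.card_range_le {A : ZFSet.{u}} (f : A → ZFSet.{u}) : (range f).card ≤ A.card := by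
  simpa [ZFSet.cardinalMk_coe_sort] using ZFSet.lift_card_range_le (f := f)

open ZFSet in
/-- The collapse of a set of small cardinality given by an `∈`-isomorphism from a level. -/
theorem IsMemIso.exists_collapse {b n g : ZFSet} {β : Ordinal} (h : IsMemIso b n g)
    (hb : b = V_ β) : Cardinal.mk n ≤ Cardinal.mk b ∧ ∃ π : ZFSet → ZFSet,
      (∀ x ∈ {x | x ∈ n}, ∀ z, z ∈ π x ↔ ∃ y ∈ {x | x ∈ n}, y ∈ x ∧ π y = z) ∧
      π '' {x | x ∈ n} = Vset β := by
  choose! π hπb hπ using h.right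
  have uniq : ∀ x ∈ b, ∀ y ∈ n, pair x y ∈ g → π y = x := fun x hx y hy hxy =>
    (h.inj_iff _ (hπb y hy) _ hy _ hx _ hy (hπ y hy) hxy).2 rfl
  refine ⟨?_, π, ?_, ?_⟩
  · refine Cardinal.mk_le_of_injective (f := fun y : n => (⟨π y, hπb y y.2⟩ : b)) ?_
    intro y y' hy
    exact Subtype.ext ((h.inj_iff _ (hπb y y.2) _ y.2 _ (hπb y' y'.2) _ y'.2 (hπ y y.2)
      (hπ y' y'.2)).1 (congrArg Subtype.val hy))
  · intro x hx z
    constructor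
    · intro hz
      have hzb : z ∈ b := by
        have := hπb x hx
        subst hb
        exact isTransitive_vonNeumann _ _ this hz
      obtain ⟨y, hy, hzy⟩ := h.left z hzb
      exact ⟨y, hy, (h.mem_iff _ hzb _ hy _ (hπb x hx) _ hx hzy (hπ x hx)).1 hz,
        uniq _ hzb _ hy hzy⟩
    · rintro ⟨y, hy, hyx, rfl⟩
      exact (h.mem_iff _ (hπb y hy) _ hy _ (hπb x hx) _ hx (hπ y hy) (hπ x hx)).2 hyx
  · ext x
    have : x ∈ Vset β ↔ x ∈ b := by rw [hb, mem_vonNeumann]; rfl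
    rw [this]
    constructor
    · rintro ⟨y, hy, rfl⟩
      exact hπb y hy
    · intro hx
      obtain ⟨y, hy, hxy⟩ := h.left x hx
      exact ⟨y, hy, uniq x hx y hy hxy⟩

open ZFSet in
theorem IsLevelIn.eq_vonNeumann {a : ZFSet} (h : IsLevelIn (fun _ => True) a) : a = V_ a.rank := by
  obtain ⟨γ, hγ⟩ := h.exists_rank (by simp) trivial
  have : a = V_ γ := by ext y; simp [hγ, mem_vonNeumann]
  rw [this, rank_vonNeumann]

open ZFSet in
theorem Supercompact.twoSortedReflection {κ : Ordinal.{0}} (h : Supercompact κ) :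
    TwoSortedReflection κ := by
  intro lam hlam φ ρ hρ hev
  obtain ⟨Mc, j, htr, hjM, helem, hfix, hcrit, hc⟩ :=
    h (max lam (V_ lam).card.ord) (hlam.le.trans (le_max_left _ _))
  have hj : IsElemEmb Mc j := ⟨htr, hjM, helem⟩
  have hc : IsClosedUnderSeq Mc (max lam (V_ lam).card.ord) := hc
  have hsmall : ∀ A : ZFSet, (∀ x ∈ A, x ∈ Mc) → A.card ≤ (V_ lam).card → A ∈ Mc := by
    intro A hA hcard
    refine hj.mem_of_subset hc hA (hcard.trans ?_)
    refine (Cardinal.card_ord (V_ lam).card).ge.trans ?_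
    exact Ordinal.card_le_card (le_max_right _ _)
  have hV : ∀ x, x ∈ V_ lam → x ∈ Mc := by
    intro x
    induction x using ZFSet.inductionOn with
    | h x ih =>
      intro hx
      have hsub : x ⊆ V_ lam := (isTransitive_vonNeumann lam).subset_of_mem hx
      exact hsmall x (fun y hy => ih y hy (hsub hy)) (card_mono hsub)
  have hsub : ∀ A : ZFSet, A ⊆ V_ lam → A ∈ Mc := fun A hA =>
    hsmall A (fun y hy => hV y (hA hy)) (card_mono hA)
  have hκlam : V_ κ ∈ V_ lam := by simpa using hlam
  have hκV : V_ κ ⊆ V_ lam := (isTransitive_vonNeumann lam).subset_of_mem hκlam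
  have hfix' : ∀ x ∈ V_ κ, j x = x := fun x hx =>
    hj.map_eq_self hfix (mem_vonNeumann.1 hx)
  have hinj : Function.Injective j := fun x y h => hj.inj_iff.1 h
  let n : ZFSet := ZFSet.range fun x : V_ lam => j x
  let g : ZFSet := ZFSet.range fun x : V_ lam => pair x (j x)
  have hn : ∀ y, y ∈ n ↔ ∃ x ∈ V_ lam, j x = y := by
    intro y; simp [n, ZFSet.mem_range]
  have hg : ∀ x y, pair x y ∈ g ↔ x ∈ V_ lam ∧ y = j x := by
    intro x y
    simp only [g, ZFSet.mem_range, Subtype.exists, pair_inj]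
    constructor
    · rintro ⟨x', hx', rfl, rfl⟩
      exact ⟨hx', rfl⟩
    · rintro ⟨hx, rfl⟩
      exact ⟨x, hx, rfl, rfl⟩
  have hnM : n ∈ Mc := hsmall n (by
    intro y hy
    obtain ⟨x, -, rfl⟩ := (hn y).1 hy
    exact hjM x) (card_range_le _)
  have hgM : g ∈ Mc := hsmall g (by
    intro y hy
    obtain ⟨x, rfl⟩ := ZFSet.mem_range.1 hy
    exact hj.pair_mem (hV _ x.2) (hjM _)) (card_range_le _)
  let σ : ℕ → ZFSet := fun i => if i = 0 then V_ κ else ρ (TS.decode i)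
  have hσ : ∀ v, σ (TS.code v) = ρ v := by
    intro v
    have : TS.code v ≠ 0 := by have := TS.le_code v; omega
    simp [σ, this]
  have key : FOF.Eval (· ∈ ·) (· ∈ Mc) φ.reflectsF (fun i => j (σ i)) := by
    rw [TS.eval_reflectsF htr]
    refine ⟨V_ κ, hV _ hκlam, V_ lam, hsub _ (fun _ h => h), n, hnM, g, hgM, ?_, ?_, hκlam,
      ?_, ⟨?_, ?_, ?_, ?_⟩, ?_, ?_⟩
    · exact isLevelIn_vonNeumann (hsub _ fun x hx => hκV (mem_sep.1 hx).1)
    · exact isLevelIn_vonNeumann (hsub _ fun x hx => (mem_sep.1 hx).1)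
    · simp only [σ, if_true, hj.mem_map_vonNeumann, rank_vonNeumann]
      exact ⟨hsub _ (fun _ h => h), (le_max_left _ _).trans_lt
        (hcrit _ (isOrdinal_toZFSet κ) (Ordinal.rank_toZFSet κ)).2⟩
    · exact fun x hx => ⟨j x, (hn _).2 ⟨x, hx, rfl⟩, (hg _ _).2 ⟨hx, rfl⟩⟩
    · intro y hy
      obtain ⟨x, hx, rfl⟩ := (hn y).1 hy
      exact ⟨x, hx, (hg _ _).2 ⟨hx, rfl⟩⟩
    · intro x _ y _ x' _ y' _ hxy hxy'
      rw [((hg _ _).1 hxy).2, ((hg _ _).1 hxy').2, hj.mem_iff]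
    · intro x _ y _ x' _ y' _ hxy hxy'
      rw [((hg _ _).1 hxy).2, ((hg _ _).1 hxy').2, hj.inj_iff]
    · intro v hv
      have := hρ v hv
      rw [hσ]
      split_ifs with hb
      · rw [if_pos hb] at this
        exact (hn _).2 ⟨_, mem_vonNeumann.2 this, rfl⟩
      · rw [if_neg hb] at this
        rwa [hfix' _ (mem_vonNeumann.2 this), mem_vonNeumann]
    · simp only [hσ]
      rw [← TS.eval_image (fun x y => hj.mem_iff) hinj] at hev
      convert hev using 1
      · ext x
        constructor
        · intro hx
          exact ⟨x, mem_vonNeumann.1 hx, hfix' x hx⟩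
        · rintro ⟨x, hx, rfl⟩
          have hx : x ∈ V_ κ := mem_vonNeumann.2 hx
          change j x ∈ V_ κ
          rwa [hfix' x hx]
      · ext x
        simp only [Set.mem_ofPred_eq, hn, mem_vonNeumann, Set.mem_image]
        rfl
  rw [← helem, TS.eval_reflectsF (by simp)] at key
  obtain ⟨a, -, b, -, n', -, g', -, hr⟩ := key
  have ha := hr.level_left.eq_vonNeumann
  have hb := hr.level_right.eq_vonNeumann
  have hbκ : b.rank < κ := by
    simpa [σ, mem_vonNeumann] using hr.right_mem
  have hab : a.rank < b.rank := rank_lt_of_mem hr.left_mem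
  obtain ⟨hcard, π, hπ, him⟩ := hr.iso.exists_collapse hb
  have haV : {x | x ∈ a} = Vset a.rank := by
    ext x
    rw [Set.mem_ofPred_eq, ha, mem_vonNeumann, rank_vonNeumann]
    rfl
  refine ⟨a.rank, hab.trans hbκ, {x | x ∈ n'}, ?_, ?_, ?_, ?_, π, hπ, b.rank, hab, him⟩
  · refine lt_of_le_of_lt hcard ?_
    rw [cardinalMk_coe_sort, Cardinal.lift_lt, hb, card_vonNeumann]
    exact (Cardinal.preBeth_le_beth _).trans_lt (Cardinal.beth_strictMono hbκ)
  · intro v hv hv0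
    have := hr.params v hv
    rw [hσ, hv0, if_neg (by simp)] at this
    rw [← haV]
    exact this
  · intro v hv hv1
    have := hr.params v hv
    rw [hσ, hv1, if_pos rfl] at this
    exact this
  · rw [← haV]
    simpa only [hσ] using hr.eval

section Collapse

variable {α : Type*} {E : α → α → Prop}

/-- The Mostowski collapse of a well-founded relation with small sets of predecessors. -/
theorem WellFounded.exists_collapse [∀ F, Small.{u} {G // E G F}] (hE : WellFounded E) :
    ∃ c : α → ZFSet.{u}, ∀ F x, x ∈ c F ↔ ∃ G, E G F ∧ c G = x := by
  refine ⟨hE.fix fun F c => ZFSet.range fun G : {G // E G F} => c G.1 G.2, fun F x => ?_⟩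
  rw [hE.fix_eq, ZFSet.mem_range]
  simp

theorem collapse_injective (hE : WellFounded E)
    (hext : ∀ F F', (∀ G, E G F ↔ E G F') → F = F') {c : α → ZFSet.{u}}
    (hc : ∀ F x, x ∈ c F ↔ ∃ G, E G F ∧ c G = x) : Function.Injective c := by
  intro F
  induction F using hE.induction with
  | _ F ih =>
    intro F' h
    refine hext _ _ fun G => ⟨fun hG => ?_, fun hG => ?_⟩
    · obtain ⟨G', hG', h'⟩ := (hc F' (c G)).1 (h ▸ (hc F _).2 ⟨G, hG, rfl⟩)
      exact ih G hG h'.symm ▸ hG'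
    · obtain ⟨G', hG', h'⟩ := (hc F (c G)).1 (h.symm ▸ (hc F' _).2 ⟨G, hG, rfl⟩)
      exact ih G' hG' h' ▸ hG'

theorem FOF.eval_collapse {c : α → ZFSet.{u}} (hc : ∀ F x, x ∈ c F ↔ ∃ G, E G F ∧ c G = x)
    (hinj : Function.Injective c) (φ : FOF) (ρ : ℕ → α) :
    FOF.Eval (· ∈ ·) (· ∈ Set.range c) φ (fun i => c (ρ i)) ↔
      FOF.Eval E (fun _ => True) φ ρ := by
  have hu : ∀ (ρ : ℕ → α) i F, Function.update (fun k => c (ρ k)) i (c F) =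
      fun k => c (Function.update ρ i F k) := fun ρ i F => (Function.comp_update c ρ i F).symm
  induction φ generalizing ρ with
  | eq i k => exact hinj.eq_iff
  | mem i k =>
    refine (hc _ _).trans ⟨?_, fun h => ⟨_, h, rfl⟩⟩
    rintro ⟨G, hG, h⟩
    obtain rfl := hinj h
    exact hG
  | not φ ih => exact not_congr (ih _)
  | and φ ψ ih ih' => exact and_congr (ih _) (ih' _)
  | or φ ψ ih ih' => exact or_congr (ih _) (ih' _)
  | all i φ ih => simp only [FOF.Eval, Set.forall_mem_range, hu, ih, true_imp_iff]
  | ex i φ ih => simp only [FOF.Eval, Set.exists_range_iff, hu, ih, true_and]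

end Collapse

section Ultrapower

open Filter

variable {I : Type*} {U : Ultrafilter I}

/-- Membership in the ultrapower of the universe. -/
def germMem (U : Ultrafilter I) : Germ (U : Filter I) ZFSet.{u} → Germ (U : Filter I) ZFSet.{u} →
    Prop := Germ.LiftRel (· ∈ ·)

theorem germMem_coe {f g : I → ZFSet.{u}} :
    germMem U (f : Germ (U : Filter I) ZFSet.{u}) g ↔ ∀ᶠ p in (U : Filter I), f p ∈ g p := Iff.rfl

/-- Łoś's theorem for the ultrapower of the universe. -/
theorem FOF.eval_germ (φ : FOF) (f : ℕ → I → ZFSet.{u}) :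
    FOF.Eval (germMem U) (fun _ => True) φ (fun i => (f i : Germ (U : Filter I) ZFSet.{u})) ↔
      ∀ᶠ p in (U : Filter I), FOF.Eval (· ∈ ·) (fun _ => True) φ (fun i => f i p) := by
  have hu : ∀ (f : ℕ → I → ZFSet.{u}) i (g : I → ZFSet.{u}),
      Function.update (fun k => (f k : Germ (U : Filter I) ZFSet.{u})) i g =
        fun k => ((Function.update f i g k : I → ZFSet.{u}) : Germ (U : Filter I) ZFSet.{u}) :=
    fun f i g => (Function.comp_update (fun h : I → ZFSet.{u} =>
      (h : Germ (U : Filter I) ZFSet.{u})) f i g).symm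
  have hu' : ∀ (f : ℕ → I → ZFSet.{u}) i (g : I → ZFSet.{u}) p,
      (fun k => Function.update f i g k p) = Function.update (fun k => f k p) i (g p) :=
    fun f i g p => Function.comp_update (fun h : I → ZFSet.{u} => h p) f i g
  have hex : ∀ (f : ℕ → I → ZFSet.{u}) i φ, (∀ f : ℕ → I → ZFSet.{u},
      FOF.Eval (germMem U) (fun _ => True) φ (fun i => (f i : Germ (U : Filter I) ZFSet.{u})) ↔
      ∀ᶠ p in (U : Filter I), FOF.Eval (· ∈ ·) (fun _ => True) φ (fun i => f i p)) →
      ((∃ x, FOF.Eval (germMem U) (fun _ => True) φ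
        (Function.update (fun i => (f i : Germ (U : Filter I) ZFSet.{u})) i x)) ↔
      ∀ᶠ p in (U : Filter I), ∃ x, FOF.Eval (· ∈ ·) (fun _ => True) φ
        (Function.update (fun i => f i p) i x)) := by
    intro f i φ ih
    constructor
    · rintro ⟨x, hx⟩
      induction x using Germ.inductionOn with
      | _ g =>
        rw [hu, ih] at hx
        filter_upwards [hx] with p hp
        rw [hu'] at hp
        exact ⟨_, hp⟩
    · intro h
      obtain ⟨g, hg⟩ := h.choice
      refine ⟨g, ?_⟩
      rw [hu, ih]
      filter_upwards [hg] with p hp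
      rwa [hu']
  induction φ generalizing f with
  | eq i k => exact Germ.coe_eq
  | mem i k => rfl
  | not φ ih => exact (not_congr (ih _)).trans Ultrafilter.eventually_not.symm
  | and φ ψ ih ih' => exact (and_congr (ih _) (ih' _)).trans eventually_and.symm
  | or φ ψ ih ih' => exact (or_congr (ih _) (ih' _)).trans Ultrafilter.eventually_or.symm
  | all i φ ih =>
    have := not_congr (hex f i (.not φ) fun f =>
      (not_congr (ih f)).trans Ultrafilter.eventually_not.symm)
    rw [← Ultrafilter.eventually_not] at this
    simpa [FOF.Eval] using this
  | ex i φ ih => simpa only [FOF.Eval, true_and] using hex f i φ ih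

theorem germMem_ext (F F' : Germ (U : Filter I) ZFSet.{u})
    (h : ∀ G, germMem U G F ↔ germMem U G F') : F = F' := by
  have key : FOF.Eval (germMem U) (fun _ => True)
      (.all 0 (.all 1 (.or (.ex 2 (.or (.and (.mem 2 0) (.not (.mem 2 1)))
        (.and (.not (.mem 2 0)) (.mem 2 1)))) (.eq 0 1))))
      (fun _ => ((fun _ => ∅ : I → ZFSet.{u}) : Germ (U : Filter I) ZFSet.{u})) := by
    rw [FOF.eval_germ]
    refine Eventually.of_forall fun p => ?_
    simp only [FOF.Eval]
    intro x _ y _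
    by_contra hn
    simp only [true_and, not_or, not_exists, Function.update_self] at hn
    refine hn.2 (ZFSet.ext fun z => ?_)
    have := hn.1 z
    simp at this ⊢
    tauto
  simp only [FOF.Eval] at key
  rcases key F trivial F' trivial with ⟨G, -, hG⟩ | he
  · have := h G
    simp at hG
    tauto
  · simpa using he

theorem small_germMem [Small.{u} I] (F : Germ (U : Filter I) ZFSet.{u}) :
    Small.{u} {G // germMem U G F} := by
  induction F using Germ.inductionOn with
  | _ f =>
    let S := Set.range fun h : (∀ p : I, ↥(insert ∅ (f p) : ZFSet.{u})) =>
      ((fun p => (h p).1 : I → ZFSet.{u}) : Germ (U : Filter I) ZFSet.{u})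
    have : Small.{u} S := small_range _
    refine small_subset (s := S) (t := {G | germMem U G f}) fun G hG => ?_
    induction G using Germ.inductionOn with
    | _ g =>
      classical
      refine ⟨fun p => if h : g p ∈ f p then ⟨g p, by simp [h]⟩ else ⟨∅, by simp⟩, ?_⟩
      refine Germ.coe_eq.2 ?_
      filter_upwards [germMem_coe.1 hG] with p hp
      simp [hp]

theorem wellFounded_germMem (hU : ∀ g : I → ℕ, ∃ n, ∀ᶠ p in (U : Filter I), g p = n) :
    WellFounded (germMem U : Germ (U : Filter I) ZFSet.{u} → _ → Prop) := by
  rw [wellFounded_iff_isEmpty_descending_chain]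
  refine ⟨fun ⟨F, hF⟩ => ?_⟩
  choose f hf using fun n => Quotient.exists_rep (F n)
  have hf' : ∀ n, ∀ᶠ p in (U : Filter I), f (n + 1) p ∈ f n p := by
    intro n
    have := hF n
    rw [← hf, ← hf] at this
    exact germMem_coe.1 this
  have : ∀ p, ∃ n, f (n + 1) p ∉ f n p := by
    intro p
    by_contra! hn
    exact (wellFounded_iff_isEmpty_descending_chain.1 ZFSet.mem_wf).false ⟨fun n => f n p, hn⟩
  choose g hg using this
  obtain ⟨n, hn⟩ := hU g
  obtain ⟨p, hp, hp'⟩ := (hn.and (hf' n)).exists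
  exact hg p (hp ▸ hp')

end Ultrapower

open ZFSet Filter in
/-- A fine normal ultrafilter on sets `P p` whose collapses send `lam` below `κ` witnesses
`lam`-supercompactness of `κ`. -/
theorem LambdaSupercompact.of_ultrafilter {κ lam : Ordinal.{0}} {I : Type*} [Small.{0} I]
    {U : Ultrafilter I} {P : I → ZFSet.{0}} {W : ZFSet.{0}} (hW : W.IsTransitive)
    (hκW : V_ κ ⊆ W) (hlam : lam.toZFSet ∈ W)
    (hω : ∀ g : I → ℕ, ∃ n, ∀ᶠ p in (U : Filter I), g p = n)
    (hnormal : ∀ f : I → ZFSet.{0}, (∀ᶠ p in (U : Filter I), f p ∈ P p ∧ f p ∈ W) →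
      ∃ w ∈ W, ∀ᶠ p in (U : Filter I), f p = w)
    (hfine : ∀ w ∈ W, ∀ᶠ p in (U : Filter I), w ∈ P p)
    (hP : ∀ p, ∀ x ∈ P p, x ∈ V_ κ → x ⊆ P p) (π : I → ZFSet.{0} → ZFSet.{0})
    (hπ : ∀ p, ∀ x ∈ P p, x ∈ W → ∀ z, z ∈ π p x ↔ ∃ y ∈ P p, y ∈ x ∧ π p y = z)
    (hπlam : ∀ p, π p lam.toZFSet ∈ V_ κ) : LambdaSupercompact κ lam := by
  have hsm := fun F : Germ (U : Filter I) ZFSet.{0} => small_germMem F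
  have hwf : WellFounded (germMem U : Germ (U : Filter I) ZFSet.{0} → _ → Prop) :=
    wellFounded_germMem hω
  obtain ⟨c, hc⟩ := hwf.exists_collapse
  have hinj := collapse_injective hwf germMem_ext hc
  let C : (I → ZFSet.{0}) → ZFSet.{0} := fun f => c (f : Germ (U : Filter I) ZFSet.{0})
  let j : ZFSet.{0} → ZFSet.{0} := fun x => C fun _ => x
  have hCmem : ∀ f x, x ∈ C f ↔ ∃ g, (∀ᶠ p in (U : Filter I), g p ∈ f p) ∧ C g = x := by
    intro f x
    refine (hc _ _).trans ⟨?_, fun ⟨g, hg, h⟩ => ⟨g, hg, h⟩⟩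
    rintro ⟨G, hG, h⟩
    induction G using Germ.inductionOn with
    | _ g => exact ⟨g, hG, h⟩
  have hCeq : ∀ f g, (∀ᶠ p in (U : Filter I), f p = g p) → C f = C g := fun f g h =>
    congrArg c (Germ.coe_eq.2 h)
  have hj : IsElemEmb (Set.range c) j := by
    refine ⟨?_, fun x => ⟨_, rfl⟩, fun φ ρ => ?_⟩
    · rintro _ ⟨F, rfl⟩ y hy
      obtain ⟨G, -, h⟩ := (hc _ _).1 hy
      exact ⟨G, h⟩
    · rw [FOF.eval_collapse hc hinj, FOF.eval_germ]
      simp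
  have hfix : ∀ x, x ∈ V_ κ → j x = x := by
    intro x
    induction x using ZFSet.inductionOn with
    | h x ih =>
      intro hx
      have hsub : x ⊆ V_ κ := (isTransitive_vonNeumann κ).subset_of_mem hx
      ext y
      constructor
      · intro hy
        obtain ⟨g, hg, rfl⟩ := (hCmem _ _).1 hy
        obtain ⟨w, -, hw⟩ := hnormal g (by
          filter_upwards [hg, hfine x (hκW hx)] with p hp hxp
          exact ⟨hP p x hxp hx hp, hκW (hsub hp)⟩)
        obtain ⟨p, hp, hp'⟩ := (hw.and hg).exists
        have hwx : w ∈ x := hp ▸ hp'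
        rw [hCeq g _ hw]
        change j w ∈ x
        rwa [ih w hwx (hsub hwx)]
      · intro hy
        exact (hCmem _ _).2 ⟨_, Eventually.of_forall fun _ => hy, ih y hy (hsub hy)⟩
  have hcoll : ∀ x, x ∈ W → C (fun p => π p x) = x := by
    intro x
    induction x using ZFSet.inductionOn with
    | h x ih =>
      intro hx
      have hsub : x ⊆ W := hW.subset_of_mem hx
      ext y
      constructor
      · intro hy
        obtain ⟨g, hg, rfl⟩ := (hCmem _ _).1 hy
        have : ∀ᶠ p in (U : Filter I), ∃ y, (y ∈ P p ∧ y ∈ x) ∧ π p y = g p := by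
          filter_upwards [hg, hfine x hx] with p hp hxp
          obtain ⟨y, h1, h2, h3⟩ := (hπ p x hxp hx _).1 hp
          exact ⟨y, ⟨h1, h2⟩, h3⟩
        obtain ⟨h, hh⟩ := this.choice
        obtain ⟨w, -, hw⟩ := hnormal h (hh.mono fun p hp => ⟨hp.1.1, hsub hp.1.2⟩)
        obtain ⟨p, hp, hp'⟩ := (hw.and hh).exists
        have hwx : w ∈ x := hp ▸ hp'.1.2
        rw [hCeq g (fun p => π p w) (by
          filter_upwards [hw, hh] with p h1 h2
          rw [← h1, h2.2])]
        rwa [ih w hwx (hsub hwx)]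
      · intro hy
        refine (hCmem _ _).2 ⟨fun p => π p y, ?_, ih y hy (hsub hy)⟩
        filter_upwards [hfine x hx, hfine y (hsub hy)] with p hxp hyp
        exact (hπ p x hxp hx _).2 ⟨y, hyp, hy, rfl⟩
  have hclosed : ∀ (A : ZFSet) (e : ZFSet → ZFSet), (∀ a ∈ A, a ∈ Set.range c) →
      (∀ a ∈ A, ∃ w ∈ W, e w = a) → A ∈ Set.range c := by
    intro A e hA he
    have : ∀ w, ∃ f : I → ZFSet, e w ∈ A → C f = e w := by
      intro w
      by_cases h : e w ∈ A
      · obtain ⟨F, hF⟩ := hA _ h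
        induction F using Germ.inductionOn with
        | _ f => exact ⟨f, fun _ => hF⟩
      · exact ⟨fun _ => ∅, fun h' => absurd h' h⟩
    choose F hF using this
    let H : I → ZFSet := fun p =>
      ZFSet.range fun w : ((P p).sep fun w => w ∈ W ∧ e w ∈ A : ZFSet) => F w p
    have hH : ∀ p y, y ∈ H p ↔ ∃ w, (w ∈ P p ∧ w ∈ W ∧ e w ∈ A) ∧ F w p = y := by
      intro p y; simp [H, ZFSet.mem_range, ZFSet.mem_sep]
    refine ⟨(H : Germ (U : Filter I) ZFSet), ?_⟩
    change C H = A
    ext y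
    constructor
    · intro hy
      obtain ⟨g, hg, rfl⟩ := (hCmem _ _).1 hy
      obtain ⟨h, hh⟩ := (hg.mono fun p hp => (hH p _).1 hp).choice
      obtain ⟨w, -, hw⟩ := hnormal h (hh.mono fun p hp => ⟨hp.1.1, hp.1.2.1⟩)
      obtain ⟨p, hp, hp'⟩ := (hw.and hh).exists
      have hwA : e w ∈ A := hp ▸ hp'.1.2.2
      rw [hCeq g (F w) (by
        filter_upwards [hw, hh] with p h1 h2
        rw [← h1, h2.2]), hF w hwA]
      exact hwA
    · intro hy
      obtain ⟨w, hw, rfl⟩ := he y hy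
      refine (hCmem _ _).2 ⟨F w, ?_, hF w hy⟩
      filter_upwards [hfine w hw] with p hp
      exact (hH p _).2 ⟨w, ⟨hp, hw, hy⟩, rfl⟩
  have hlamM : lam.toZFSet ∈ Set.range c := ⟨_, hcoll _ hlam⟩
  refine ⟨Set.range c, j, hj.trans, hj.map_mem, hj.elem, fun x _ hx =>
    hfix x (mem_vonNeumann.2 hx), ?_, ?_⟩
  · intro x hx hxκ
    refine ⟨hj.isOrdinal hx, ?_⟩
    have h : lam.toZFSet ∈ j (V_ κ) :=
      (hCmem _ _).2 ⟨_, Eventually.of_forall hπlam, hcoll _ hlam⟩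
    rw [hj.mem_map_vonNeumann, Ordinal.rank_toZFSet] at h
    rw [← hx.toZFSet_rank_eq, hxκ]
    exact h.2
  · intro d f hd hdlam hf hfM
    obtain rfl : d = lam.toZFSet := by rw [← hdlam, hd.toZFSet_rank_eq]
    choose! g hg using fun a ha => (hf.2 a ha).exists
    refine hclosed f (fun a => pair a (g a)) ?_ ?_
    · intro p hp
      obtain ⟨a, b, ha, rfl⟩ := hf.1 p hp
      exact hj.pair_mem (hj.trans _ hlamM _ ha) (hfM a b ha hp)
    · intro p hp
      obtain ⟨a, b, ha, rfl⟩ := hf.1 p hp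
      refine ⟨a, hW _ hlam ha, ?_⟩
      rw [(hf.2 a ha).unique (hg a ha) hp]

namespace SuperMeasure

open ZFSet

/-- `p` is closed under the elements of its members in `V_ κ`, and collapses `lam` below `κ`. -/
structure IsIndex (κ lam : Ordinal.{0}) (p : ZFSet.{0}) : Prop where
  top_mem : V_ (lam + 1) ∈ p
  nat_mem : ∀ n : ℕ, (n : Ordinal).toZFSet ∈ p
  subset : ∀ x ∈ p, x ∈ V_ κ → x ⊆ p
  collapse : ∃ π : ZFSet → ZFSet, (∀ x ∈ p, x ∈ V_ (lam + 1) → ∀ z, z ∈ π x ↔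
    ∃ y ∈ p, y ∈ x ∧ π y = z) ∧ π lam.toZFSet ∈ V_ κ

/-- The set on which the ultrafilter lives. -/
noncomputable def index (κ lam : Ordinal.{0}) : ZFSet.{0} :=
  (powerset (insert (V_ (lam + 1)) (V_ (lam + 1)))).sep (IsIndex κ lam)

variable {κ lam : Ordinal.{0}} {p w : ZFSet.{0}}

theorem isIndex_of_mem (hp : p ∈ index κ lam) : IsIndex κ lam p := (mem_sep.1 hp).2

theorem notMem_index (hw : w ∈ V_ (lam + 1)) : w ∉ index κ lam := fun h =>
  mem_asymm hw (isIndex_of_mem h).top_mem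

/-- The set of indices satisfying `C`, tagged by `w`. -/
noncomputable def tag (κ lam : Ordinal.{0}) (w : ZFSet.{0}) (C : ZFSet.{0} → Prop) : ZFSet.{0} :=
  insert w ((index κ lam).sep C)

/-- The set of all sets of indices and tags. -/
noncomputable def events (κ lam : Ordinal.{0}) : ZFSet.{0} :=
  powerset (V_ (lam + 1) ∪ index κ lam)

theorem mem_tag {C : ZFSet.{0} → Prop} (hp : p ∈ index κ lam) (hw : w ∈ V_ (lam + 1)) :
    p ∈ tag κ lam w C ↔ C p := by
  have : p ≠ w := fun h => notMem_index hw (h ▸ hp)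
  simp [tag, this, hp]

theorem mem_tag_iff_eq {C : ZFSet.{0} → Prop} {v : ZFSet.{0}} (hv : v ∈ V_ (lam + 1)) :
    v ∈ tag κ lam w C ↔ v = w := by
  simp [tag, notMem_index hv]

theorem tag_mem_events {C : ZFSet.{0} → Prop} (hw : w ∈ V_ (lam + 1)) :
    tag κ lam w C ∈ events κ lam := by
  rw [events, mem_powerset]
  intro x hx
  rw [mem_union]
  rcases mem_insert_iff.1 hx with rfl | hx
  · exact .inl hw
  · exact .inr (mem_sep.1 hx).1

/-- `f` is regressive on the index set. -/
def Regressive (κ lam : Ordinal.{0}) (f : ZFSet.{0} → ZFSet.{0}) : Prop :=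
  ∀ p ∈ index κ lam, f p ∈ p ∧ f p ∈ V_ (lam + 1)

/-- The events in `u` generate a fine normal filter. -/
structure IsGood (κ lam : Ordinal.{0}) (u : ZFSet.{0}) : Prop where
  normal : ∀ f, Regressive κ lam f → ∃ w ∈ V_ (lam + 1), tag κ lam w (f · = w) ∈ u
  fine : ∀ w ∈ V_ (lam + 1), tag κ lam w (w ∈ ·) ∈ u
  nonempty : ∀ X ∈ events κ lam, X ∈ u → ∃ p ∈ X, p ∈ index κ lam
  inter : ∀ X ∈ events κ lam, ∀ Y ∈ events κ lam, X ≠ Y → X ∈ u → Y ∈ u →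
    ∃ p ∈ X, p ∈ Y ∧ p ∈ index κ lam

theorem natCast_toZFSet_mem (hω : Ordinal.omega0 ≤ lam) (n : ℕ) :
    (n : Ordinal).toZFSet ∈ V_ (lam + 1) := by
  rw [mem_vonNeumann, Ordinal.rank_toZFSet]
  exact (Ordinal.natCast_lt_omega0 n).trans_le (hω.trans (le_of_lt (Order.lt_add_one_iff.2 le_rfl)))

theorem IsGood.exists_mem {u : ZFSet.{0}} (hu : IsGood κ lam u) (hω : Ordinal.omega0 ≤ lam)
    (l : List ZFSet.{0}) (hl : ∀ X ∈ l, X ∈ events κ lam ∧ X ∈ u) :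
    ∃ p ∈ index κ lam, ∀ X ∈ l, p ∈ X := by
  by_contra! hn
  have : ∀ p, ∃ n : ℕ, p ∈ index κ lam → ∃ h : n < l.length, p ∉ l[n] := by
    intro p
    by_cases hp : p ∈ index κ lam
    · obtain ⟨X, hX, hpX⟩ := hn p hp
      obtain ⟨n, h, rfl⟩ := List.getElem_of_mem hX
      exact ⟨n, fun _ => ⟨h, hpX⟩⟩
    · exact ⟨0, fun h => absurd h hp⟩
  choose g hg using this
  obtain ⟨w, hw, hwu⟩ := hu.normal (fun p => ((g p : ℕ) : Ordinal).toZFSet) fun p hp =>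
    ⟨(isIndex_of_mem hp).nat_mem _, natCast_toZFSet_mem hω _⟩
  have hwe := tag_mem_events (C := fun p => ((g p : ℕ) : Ordinal).toZFSet = w) (κ := κ) hw
  obtain ⟨p, hp, hpI⟩ := hu.nonempty _ hwe hwu
  have hpw := (mem_tag hpI hw).1 hp
  obtain ⟨hlt, -⟩ := hg p hpI
  have hdisj : ∀ q ∈ index κ lam, q ∈ tag κ lam w (fun p => ((g p : ℕ) : Ordinal).toZFSet = w) →
      q ∉ l[g p] := by
    intro q hq hqt
    have h := (mem_tag hq hw).1 hqt
    rw [← hpw] at h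
    have : g q = g p := by simpa using Ordinal.toZFSet_injective h
    obtain ⟨h1, h2⟩ := hg q hq
    simpa [this] using h2
  obtain ⟨hX, hXu⟩ := hl l[g p] (List.getElem_mem hlt)
  by_cases heq : tag κ lam w (fun p => ((g p : ℕ) : Ordinal).toZFSet = w) = l[g p]
  · exact hdisj p hpI hp (heq ▸ hp)
  · obtain ⟨q, hq, hq', hqI⟩ := hu.inter _ hwe _ hX heq hwu hXu
    exact hdisj q hqI hq hq'

theorem IsGood.lambdaSupercompact {u : ZFSet.{0}} (hu : IsGood κ lam u)
    (hω : Ordinal.omega0 ≤ lam) (hκ : κ ≤ lam) : LambdaSupercompact κ lam := by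
  let S : Set (Set (index κ lam)) :=
    {A | ∃ X ∈ events κ lam, X ∈ u ∧ A = {p : index κ lam | p.1 ∈ X}}
  have hS : (Filter.generate S).NeBot := by
    rw [Filter.generate_neBot_iff]
    intro t ht hfin
    choose! X hX hXu hXt using ht
    obtain ⟨p, hp, h⟩ := hu.exists_mem hω (hfin.toFinset.toList.map X) (by
      intro Y hY
      simp only [List.mem_map, Finset.mem_toList, Set.Finite.mem_toFinset] at hY
      obtain ⟨A, hA, rfl⟩ := hY
      exact ⟨hX hA, hXu hA⟩)
    refine ⟨⟨p, hp⟩, fun A hA => ?_⟩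
    rw [hXt hA]
    exact h _ (List.mem_map.2 ⟨A, by simpa using hA, rfl⟩)
  let U := Ultrafilter.of (Filter.generate S)
  have hU : ∀ X ∈ events κ lam, X ∈ u → ∀ᶠ p : index κ lam in (U : Filter _), p.1 ∈ X :=
    fun X hX hXu => Ultrafilter.of_le _ (Filter.mem_generate_of_mem ⟨X, hX, hXu, rfl⟩)
  have hκW : V_ κ ⊆ V_ (lam + 1) := by
    intro x hx
    rw [mem_vonNeumann] at hx ⊢
    exact hx.trans (Order.lt_add_one_iff.2 hκ)
  have hnormal : ∀ f : index κ lam → ZFSet.{0}, (∀ᶠ p in (U : Filter _), f p ∈ p.1 ∧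
      f p ∈ V_ (lam + 1)) → ∃ w ∈ V_ (lam + 1), ∀ᶠ p in (U : Filter _), f p = w := by
    intro f hf
    classical
    let f' : ZFSet → ZFSet := fun p => if h : ∃ hp : p ∈ index κ lam,
      f ⟨p, hp⟩ ∈ p ∧ f ⟨p, hp⟩ ∈ V_ (lam + 1) then f ⟨p, h.1⟩ else ((0 : ℕ) : Ordinal).toZFSet
    obtain ⟨w, hw, hwu⟩ := hu.normal f' (by
      intro p hp
      by_cases h : ∃ hp : p ∈ index κ lam, f ⟨p, hp⟩ ∈ p ∧ f ⟨p, hp⟩ ∈ V_ (lam + 1)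
      · simp only [f', dif_pos h]
        exact h.2
      · simp only [f', dif_neg h]
        exact ⟨(isIndex_of_mem hp).nat_mem 0, natCast_toZFSet_mem hω 0⟩)
    refine ⟨w, hw, ?_⟩
    filter_upwards [hf, hU _ (tag_mem_events hw) hwu] with p hp hpw
    rw [mem_tag p.2 hw] at hpw
    rw [← hpw]
    simp only [f']
    rw [dif_pos ⟨p.2, hp⟩]
  have hfine : ∀ w ∈ V_ (lam + 1), ∀ᶠ p : index κ lam in (U : Filter _), w ∈ p.1 := by
    intro w hw
    filter_upwards [hU _ (tag_mem_events hw) (hu.fine w hw)] with p hp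
    exact (mem_tag p.2 hw).1 hp
  choose π hπ hπlam using fun p : index κ lam => (isIndex_of_mem p.2).collapse
  refine LambdaSupercompact.of_ultrafilter (P := fun p => p.1) (isTransitive_vonNeumann _) hκW
    (mem_vonNeumann.2 (by simp)) ?_ hnormal hfine (fun p => (isIndex_of_mem p.2).subset) π hπ hπlam
  intro g
  obtain ⟨w, -, hw⟩ := hnormal (fun p => ((g p : ℕ) : Ordinal).toZFSet)
    (Filter.Eventually.of_forall fun p =>
      ⟨(isIndex_of_mem p.2).nat_mem _, natCast_toZFSet_mem hω _⟩)
  obtain ⟨p, hp⟩ := hw.exists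
  refine ⟨g p, hw.mono fun q hq => ?_⟩
  simpa using Ordinal.toZFSet_injective (hq.trans hp.symm)

end SuperMeasure

theorem omega0_lt_of_twoSortedReflection {κ : Ordinal.{0}} (h : TwoSortedReflection κ) :
    Ordinal.omega0 < κ := by
  by_contra! hκ
  have hne : κ ≠ 0 := by
    rintro rfl
    obtain ⟨α, hα, -⟩ := h 1 one_pos (.eq (true, 0) (true, 0)) (fun _ => ∅)
      (by simp [TS.free, Vset]) (by simp [TS.Eval])
    simp at hα
  rcases Ordinal.zero_or_succ_or_isSuccLimit κ with rfl | ⟨γ, rfl⟩ | hlim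
  · exact hne rfl
  · obtain ⟨α, hα, N, -, hp, -⟩ := h _ (Order.lt_succ _) (.eq (false, 0) (false, 0))
      (fun _ => γ.toZFSet) (by simp [TS.free, Vset]) (by simp [TS.Eval])
    have := hp (false, 0) (by simp [TS.free]) rfl
    simp only [Vset, Set.mem_ofPred_eq, Ordinal.rank_toZFSet] at this
    exact (Order.lt_succ_iff.1 hα).not_gt this
  · obtain ⟨α, hα, N, -, hp, -, hev, -⟩ := h _ (Order.lt_succ κ)
      (.and (.eq (false, 0) (false, 0)) (.all (false, 1) (.ex (false, 2)
        (.mem (false, 1) (false, 2))))) (fun _ => ∅)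
      (by simpa [TS.free, Vset] using pos_iff_ne_zero.2 hne) (by
        simp only [TS.Eval, true_and]
        intro x hx
        refine ⟨{x}, ?_, by simp⟩
        simpa [Vset] using hlim.succ_lt hx)
    have h0 : ∅ ∈ Vset α := hp (false, 0) (by simp [TS.free]) rfl
    rcases Ordinal.zero_or_succ_or_isSuccLimit α with rfl | ⟨m, rfl⟩ | hlim'
    · simp [Vset] at h0
    · obtain ⟨y, hy, hxy⟩ := hev.2 m.toZFSet (by simp [Vset])
      have hxy : m.toZFSet ∈ y := by simpa [TS.Eval] using hxy
      have hy : y.rank < Order.succ m := hy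
      have := ZFSet.rank_lt_of_mem hxy
      rw [Ordinal.rank_toZFSet] at this
      exact (Order.lt_succ_iff.1 hy).not_gt this
    · exact (Ordinal.omega0_le_of_isSuccLimit hlim').not_gt (hα.trans_le hκ)

namespace SuperMeasure

open ZFSet

/-- The two-sorted formula stating that no set `u` is good. The second-sort variables
`0, …, 7` are parameters, as is the first-sort variable `0`. -/
def noGoodF : TS :=
  let y (i : ℕ) : Bool × ℕ := (true, i)
  let x (i : ℕ) : Bool × ℕ := (false, i)
  .and (.all (y 8) (.all (y 9) (.or (.eq (y 8) (y 9)) (.ex (y 10)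
    (.or (.and (.mem (y 10) (y 8)) (.not (.mem (y 10) (y 9))))
      (.and (.not (.mem (y 10) (y 8))) (.mem (y 10) (y 9))))))))
  (.and (.all (x 1) (.ex (y 8) (.and (.eq (y 8) (x 1)) (.mem (y 8) (y 0)))))
  (.and (.all (y 8) (.or (.not (.mem (y 8) (y 0))) (.ex (x 1) (.eq (x 1) (y 8)))))
  (.and (.all (y 8) (.or (.not (.mem (y 8) (y 4))) (.all (y 9) (.or (.not (.mem (y 9) (y 1)))
    (.ex (y 10) (.and (.mem (y 10) (y 8)) (.mem (y 9) (y 10))))))))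
  (.and (.and (.eq (y 2) (y 2)) (.and (.eq (y 3) (y 3)) (.eq (x 0) (x 0))))
  (.all (y 8) (.or
    (.ex (y 9) (.and (.mem (y 9) (y 4)) (.all (y 10) (.or (.not (.mem (y 10) (y 9)))
      (.not (.mem (y 10) (y 8)))))))
    (.or (.ex (y 9) (.and (.mem (y 9) (y 5)) (.and (.not (.mem (y 9) (y 8)))
      (.ex (y 10) (.and (.mem (y 10) (y 1)) (.mem (y 10) (y 9)))))))
    (.or (.ex (y 9) (.and (.mem (y 9) (y 6)) (.mem (y 9) (y 8))))
    (.ex (y 9) (.and (.mem (y 9) (y 7)) (.ex (y 10) (.and (.mem (y 10) (y 9))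
      (.ex (y 11) (.and (.mem (y 11) (y 9)) (.and (.not (.eq (y 10) (y 11)))
      (.and (.mem (y 10) (y 8)) (.mem (y 11) (y 8))))))))))))))))))

/-- The assignment of the parameters of `noGoodF`. -/
def params (a K W L Q F A B D : ZFSet.{0}) : Bool × ℕ → ZFSet.{0}
  | (false, _) => a
  | (true, 0) => K
  | (true, 1) => W
  | (true, 2) => L
  | (true, 3) => Q
  | (true, 4) => F
  | (true, 5) => A
  | (true, 6) => B
  | (true, _) => D

theorem free_noGoodF : noGoodF.free = {v | v = (false, 0) ∨ v.1 = true ∧ v.2 < 8} := by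
  ext ⟨b, n⟩
  simp only [noGoodF, TS.free]
  cases b <;> simp
  omega

/-- The meaning of `noGoodF`. -/
structure NoGood (D0 D1 : Set ZFSet.{0}) (K W F A B D : ZFSet.{0}) : Prop where
  ext : ∀ x ∈ D1, ∀ y ∈ D1, x = y ∨ ∃ z ∈ D1, z ∈ x ∧ z ∉ y ∨ z ∉ x ∧ z ∈ y
  mem_of_first : ∀ x ∈ D0, ∃ y ∈ D1, y = x ∧ y ∈ K
  first_of_mem : ∀ y ∈ D1, y ∉ K ∨ ∃ x ∈ D0, x = y
  exists_tag : ∀ f ∈ D1, f ∉ F ∨ ∀ w ∈ D1, w ∉ W ∨ ∃ X ∈ D1, X ∈ f ∧ w ∈ X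
  noGood : ∀ u ∈ D1, (∃ f ∈ D1, f ∈ F ∧ ∀ X ∈ D1, X ∉ f ∨ X ∉ u) ∨
    (∃ X ∈ D1, X ∈ A ∧ X ∉ u ∧ ∃ w ∈ D1, w ∈ W ∧ w ∈ X) ∨ (∃ X ∈ D1, X ∈ B ∧ X ∈ u) ∨
    ∃ d ∈ D1, d ∈ D ∧ ∃ X ∈ D1, X ∈ d ∧ ∃ Y ∈ D1, Y ∈ d ∧ X ≠ Y ∧ X ∈ u ∧ Y ∈ u

theorem eval_noGoodF {D0 D1 : Set ZFSet.{0}} {a K W L Q F A B D : ZFSet.{0}} :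
    TS.Eval D0 D1 noGoodF (params a K W L Q F A B D) ↔ NoGood D0 D1 K W F A B D := by
  simp [noGoodF, TS.Eval, params]
  exact ⟨fun ⟨a, b, c, d, e⟩ => ⟨by simpa using a, by simpa using b, by simpa using c,
      by simpa using d, by simpa using e⟩,
    fun ⟨a, b, c, d, e⟩ => ⟨by simpa using a, by simpa using b, by simpa using c,
      by simpa using d, by simpa using e⟩⟩

end SuperMeasure

namespace SuperMeasure

open ZFSet

variable {κ lam : Ordinal.{0}}

/-- The families of tagged fibres of regressive functions. -/
noncomputable def fibres (κ lam : Ordinal.{0}) : ZFSet.{0} :=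
  (powerset (events κ lam)).sep fun F => ∃ f, Regressive κ lam f ∧
    ∀ X, X ∈ F ↔ ∃ w ∈ V_ (lam + 1), X = tag κ lam w (f · = w)

/-- The tagged cones. -/
noncomputable def cones (κ lam : Ordinal.{0}) : ZFSet.{0} :=
  (events κ lam).sep fun X => ∃ w ∈ V_ (lam + 1), X = tag κ lam w (w ∈ ·)

/-- The events containing no index. -/
noncomputable def nullEvents (κ lam : Ordinal.{0}) : ZFSet.{0} :=
  (events κ lam).sep fun X => ∀ p ∈ X, p ∉ index κ lam

/-- The sets of events that are pairwise disjoint on the index set. -/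
noncomputable def disjointEvents (κ lam : Ordinal.{0}) : ZFSet.{0} :=
  (powerset (events κ lam)).sep fun d => ∀ X ∈ d, ∀ Y ∈ d, X ≠ Y → ∀ p ∈ X, p ∈ Y →
    p ∉ index κ lam

theorem noGood_of_forall_not_isGood {θ : Ordinal.{0}} (hκ : κ < θ)
    (hF : (fibres κ lam).rank < θ) (hA : (cones κ lam).rank < θ)
    (hB : (nullEvents κ lam).rank < θ) (hD : (disjointEvents κ lam).rank < θ)
    (h : ∀ u, ¬ IsGood κ lam u) :
    NoGood (Vset κ) (Vset θ) (V_ κ) (V_ (lam + 1)) (fibres κ lam) (cones κ lam)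
      (nullEvents κ lam) (disjointEvents κ lam) := by
  have htr : ∀ {x y : ZFSet.{0}}, x ∈ y → y.rank < θ → x.rank < θ := fun hxy hy =>
    (rank_lt_of_mem hxy).trans hy
  refine ⟨?_, ?_, ?_, ?_, ?_⟩
  · intro x hx y hy
    by_contra! hne
    refine hne.1 (ZFSet.ext fun z => ⟨fun hz => ?_, fun hz => ?_⟩)
    · exact (hne.2 z (htr hz hx)).1 hz
    · by_contra hz'
      exact (hne.2 z (htr hz hy)).2 hz' hz
  · exact fun x hx => ⟨x, lt_trans hx hκ, rfl, mem_vonNeumann.2 hx⟩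
  · intro y _
    by_cases hy : y ∈ V_ κ
    · exact .inr ⟨y, mem_vonNeumann.1 hy, rfl⟩
    · exact .inl hy
  · intro F hFθ
    by_cases hF' : F ∈ fibres κ lam
    · refine .inr fun w hw => ?_
      by_cases hwW : w ∈ V_ (lam + 1)
      · obtain ⟨-, f, -, hf⟩ := mem_sep.1 hF'
        have := (hf _).2 ⟨w, hwW, rfl⟩
        exact .inr ⟨_, htr this hFθ, this, by simp [tag]⟩
      · exact .inl hwW
    · exact .inl hF'
  · intro u _
    by_contra! hn
    obtain ⟨h1, h2, h3, h4⟩ := hn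
    refine h u ⟨?_, ?_, ?_, ?_⟩
    · intro f hf
      let F : ZFSet := (events κ lam).sep fun X => ∃ w ∈ V_ (lam + 1), X = tag κ lam w (f · = w)
      have hFm : F ∈ fibres κ lam := by
        refine mem_sep.2 ⟨mem_powerset.2 fun x hx => (mem_sep.1 hx).1, f, hf, fun X => ?_⟩
        rw [mem_sep]
        refine ⟨fun h => h.2, fun h => ⟨?_, h⟩⟩
        obtain ⟨w, hw, rfl⟩ := h
        exact tag_mem_events hw
      obtain ⟨X, -, hX, hXu⟩ := h1 F (htr hFm hF) hFm
      obtain ⟨-, w, hw, rfl⟩ := mem_sep.1 hX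
      exact ⟨w, hw, hXu⟩
    · intro w hw
      by_contra hX
      have hm : tag κ lam w (w ∈ ·) ∈ cones κ lam :=
        mem_sep.2 ⟨tag_mem_events hw, w, hw, rfl⟩
      have hwt : w ∈ tag κ lam w (w ∈ ·) := by simp [tag]
      exact h2 _ (htr hm hA) hm hX w (htr hwt (htr hm hA)) hw hwt
    · intro X hX hXu
      by_contra! hn
      have hm : X ∈ nullEvents κ lam := mem_sep.2 ⟨hX, hn⟩
      exact h3 X (htr hm hB) hm hXu
    · intro X hX Y hY hXY hXu hYu
      by_contra! hn
      have hm : ({X, Y} : ZFSet) ∈ disjointEvents κ lam := by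
        refine mem_sep.2 ⟨mem_powerset.2 fun x hx => ?_, ?_⟩
        · rcases mem_pair.1 hx with rfl | rfl <;> assumption
        · intro X' hX' Y' hY' hne p hp hp'
          rcases mem_pair.1 hX' with rfl | rfl <;> rcases mem_pair.1 hY' with rfl | rfl
          · exact absurd rfl hne
          · exact hn p hp hp'
          · exact hn p hp' hp
          · exact absurd rfl hne
      have hX' : X ∈ ({X, Y} : ZFSet) := by simp
      have hY' : Y ∈ ({X, Y} : ZFSet) := by simp
      exact h4 _ (htr hm hD) hm X (htr hX' (htr hm hD)) hX' Y (htr hY' (htr hm hD)) hY' hXY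
        hXu hYu

theorem collapse_injOn {N : Set ZFSet.{0}} {π : ZFSet.{0} → ZFSet.{0}}
    (hext : ∀ x ∈ N, ∀ y ∈ N, x = y ∨ ∃ z ∈ N, z ∈ x ∧ z ∉ y ∨ z ∉ x ∧ z ∈ y)
    (hπ : ∀ x ∈ N, ∀ z, z ∈ π x ↔ ∃ y ∈ N, y ∈ x ∧ π y = z) : Set.InjOn π N := by
  intro x
  induction x using ZFSet.inductionOn with
  | h x ih =>
    intro hx y hy hxy
    refine (hext x hx y hy).resolve_right ?_
    rintro ⟨z, hz, ⟨hzx, hzy⟩ | ⟨hzx, hzy⟩⟩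
    · obtain ⟨z', hz', hz'y, h⟩ := (hπ y hy _).1 (hxy ▸ (hπ x hx _).2 ⟨z, hz, hzx, rfl⟩)
      exact hzy (ih z hzx hz hz' h.symm ▸ hz'y)
    · obtain ⟨z', hz', hz'x, h⟩ := (hπ x hx _).1 (hxy.symm ▸ (hπ y hy _).2 ⟨z, hz, hzy, rfl⟩)
      exact hzx (ih z' hz'x hz' hz h ▸ hz'x)

/-- A small reflecting structure yields an index `s`, and the events containing `s` form a good
set from the point of view of the structure. -/
theorem not_noGood_of_collapse {α β : Ordinal.{0}} {N : Set ZFSet.{0}}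
    {π : ZFSet.{0} → ZFSet.{0}} (hα : Ordinal.omega0 ≤ α) (hβ : β < κ) (hκ : κ ≤ lam)
    (hWN : V_ (lam + 1) ∈ N) (hlamN : lam.toZFSet ∈ N) (hQN : events κ lam ∈ N)
    (hπ : ∀ x ∈ N, ∀ z, z ∈ π x ↔ ∃ y ∈ N, y ∈ x ∧ π y = z) (hπN : π '' N = Vset β) :
    ¬ NoGood (Vset α) N (V_ κ) (V_ (lam + 1)) (fibres κ lam) (cones κ lam)
      (nullEvents κ lam) (disjointEvents κ lam) := by
  intro hN
  have hinj := collapse_injOn hN.ext hπ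
  have hαN : ∀ x ∈ Vset α, x ∈ N := by
    intro x hx
    obtain ⟨y, hy, rfl, -⟩ := hN.mem_of_first x hx
    exact hy
  have hKα : ∀ x ∈ N, x ∈ V_ κ → x ∈ Vset α := by
    intro x hx hxκ
    rcases hN.first_of_mem x hx with h | ⟨y, hy, rfl⟩
    · exact absurd hxκ h
    · exact hy
  have hπβ : ∀ x ∈ N, (π x).rank < β := fun x hx => by
    have : π x ∈ Vset β := hπN ▸ Set.mem_image_of_mem π hx
    exact this
  have hWt := isTransitive_vonNeumann (lam + 1)
  have hωlam : Ordinal.omega0 ≤ lam := by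
    by_contra! hlt
    have hlt' : κ < α := (hκ.trans_lt hlt).trans_le hα
    have h1 : κ.toZFSet ∈ Vset α := by simpa [Vset] using hlt'
    obtain ⟨y, -, rfl, hy⟩ := hN.mem_of_first _ h1
    simp [mem_vonNeumann] at hy
  let s : ZFSet := (insert (V_ (lam + 1)) (V_ (lam + 1))).sep (· ∈ N)
  have hs : ∀ x, x ∈ s ↔ (x = V_ (lam + 1) ∨ x ∈ V_ (lam + 1)) ∧ x ∈ N := by
    intro x; simp [s]
  have hsI : s ∈ index κ lam := by
    refine mem_sep.2 ⟨mem_powerset.2 fun x hx => (mem_sep.1 hx).1, ?_, ?_, ?_, π, ?_, ?_⟩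
    · exact (hs _).2 ⟨.inl rfl, hWN⟩
    · intro n
      refine (hs _).2 ⟨.inr (natCast_toZFSet_mem hωlam n), hαN _ ?_⟩
      simpa [Vset] using (Ordinal.natCast_lt_omega0 n).trans_le hα
    · intro x hx hxκ y hy
      have hxN := ((hs x).1 hx).2
      have hyα : y ∈ Vset α := (rank_lt_of_mem hy).trans (hKα x hxN hxκ)
      refine (hs y).2 ⟨.inr ?_, hαN y hyα⟩
      rw [mem_vonNeumann] at hxκ ⊢
      exact ((rank_lt_of_mem hy).trans hxκ).trans (Order.lt_add_one_iff.2 hκ)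
    · intro x hx hxW z
      rw [hπ x ((hs x).1 hx).2]
      constructor
      · rintro ⟨y, hy, hyx, h⟩
        exact ⟨y, (hs y).2 ⟨.inr (hWt _ hxW hyx), hy⟩, hyx, h⟩
      · rintro ⟨y, hy, hyx, h⟩
        exact ⟨y, ((hs y).1 hy).2, hyx, h⟩
    · exact mem_vonNeumann.2 ((hπβ _ hlamN).trans hβ)
  obtain ⟨u, huN, hu⟩ : ∃ u ∈ N, ∀ X ∈ N, X ∈ events κ lam → (X ∈ u ↔ s ∈ X) := by
    let T : ZFSet := (π (events κ lam)).sep fun t =>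
      ∃ X ∈ N, X ∈ events κ lam ∧ s ∈ X ∧ π X = t
    have hT : T ∈ Vset β := by
      refine lt_of_le_of_lt (rank_mono fun x hx => (mem_sep.1 hx).1) (hπβ _ hQN)
    rw [← hπN] at hT
    obtain ⟨u, huN, hu⟩ := hT
    refine ⟨u, huN, fun X hX hXQ => ⟨fun hXu => ?_, fun hsX => ?_⟩⟩
    · have : π X ∈ T := hu ▸ (hπ u huN _).2 ⟨X, hX, hXu, rfl⟩
      obtain ⟨-, X', hX', -, hsX', he⟩ := mem_sep.1 this
      exact hinj hX' hX he ▸ hsX'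
    · have : π X ∈ T := mem_sep.2 ⟨(hπ _ hQN _).2 ⟨X, hX, hXQ, rfl⟩, X, hX, hXQ, hsX, rfl⟩
      rw [← hu] at this
      obtain ⟨y, hy, hyu, he⟩ := (hπ u huN _).1 this
      exact hinj hy hX he ▸ hyu
  rcases hN.noGood u huN with ⟨F, hFN, hF, hX⟩ | ⟨X, hXN, hX, hXu, w, hwN, hw, hwX⟩ |
    ⟨X, hXN, hX, hXu⟩ | ⟨d, hdN, hd, X, hXN, hX, Y, hYN, hY, hne, hXu, hYu⟩
  · obtain ⟨hFQ, f, hf, hFf⟩ := mem_sep.1 hF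
    obtain ⟨hfs, hfW⟩ := hf s hsI
    rcases hN.exists_tag F hFN with h | h
    · exact h hF
    · obtain ⟨X, hXN, hXF, hwX⟩ := (h (f s) ((hs _).1 hfs).2).resolve_left fun h => h hfW
      have hXu := (hX X hXN).resolve_left fun h => h hXF
      rw [hu X hXN (mem_powerset.1 hFQ hXF)] at hXu
      obtain ⟨w, hw, rfl⟩ := (hFf X).1 hXF
      exact hXu ((mem_tag hsI hw).2 ((mem_tag_iff_eq hfW).1 hwX))
  · obtain ⟨hXQ, w', hw', rfl⟩ := mem_sep.1 hX
    obtain rfl := (mem_tag_iff_eq hw).1 hwX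
    rw [hu _ hXN hXQ, mem_tag hsI hw'] at hXu
    exact hXu ((hs w).2 ⟨.inr hw, hwN⟩)
  · obtain ⟨hXQ, hX⟩ := mem_sep.1 hX
    exact hX s ((hu X hXN hXQ).1 hXu) hsI
  · obtain ⟨hdQ, hd⟩ := mem_sep.1 hd
    exact hd X hX Y hY hne s ((hu X hXN (mem_powerset.1 hdQ hX)).1 hXu)
      ((hu Y hYN (mem_powerset.1 hdQ hY)).1 hYu) hsI

end SuperMeasure

open ZFSet SuperMeasure in
theorem TwoSortedReflection.supercompact {κ : Ordinal.{0}} (hκ : ∃ c : Cardinal, c.ord = κ)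
    (h : TwoSortedReflection κ) : Supercompact κ := by
  intro lam hlam
  have hω := omega0_lt_of_twoSortedReflection h
  by_cases hgood : ∃ u, IsGood κ lam u
  · obtain ⟨u, hu⟩ := hgood
    exact hu.lambdaSupercompact (hω.le.trans hlam) hlam
  exfalso
  rw [not_exists] at hgood
  let S : ZFSet := {V_ κ, V_ (lam + 1), lam.toZFSet, events κ lam, fibres κ lam, cones κ lam,
    nullEvents κ lam, disjointEvents κ lam}
  have hS : ∀ x ∈ S, x.rank < S.rank := fun x hx => rank_lt_of_mem hx
  simp only [S, mem_insert_iff, mem_singleton, forall_eq_or_imp, forall_eq] at hS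
  obtain ⟨h0, h1, h2, h3, h4, h5, h6, h7⟩ := hS
  have hκS := h0
  rw [rank_vonNeumann] at hκS
  obtain ⟨α, hα, N, hcard, hp0, hp1, hev, π, hπ, β, hαβ, hπN⟩ := h _ hκS noGoodF
    (params Ordinal.omega0.toZFSet (V_ κ) (V_ (lam + 1)) lam.toZFSet (events κ lam)
      (fibres κ lam) (cones κ lam) (nullEvents κ lam) (disjointEvents κ lam)) (by
    rw [free_noGoodF]
    rintro ⟨b, i⟩ (hv | ⟨rfl : b = true, hi : i < 8⟩)
    · cases hv
      simpa [Vset, params] using hω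
    · interval_cases i <;> simpa only [if_true, Vset, Set.mem_ofPred_eq, params])
    (eval_noGoodF.2 (noGood_of_forall_not_isGood hκS h4 h5 h6 h7 hgood))
  have hωα : Ordinal.omega0 < α := by
    simpa [params, Vset] using hp0 (false, 0) (by simp [free_noGoodF]) rfl
  have hβ : β < κ := by
    have hlt : Cardinal.mk (Vset β) < Cardinal.lift.{1, 0} (Cardinal.beth κ) := by
      rw [← hπN]
      exact Cardinal.mk_image_le.trans_lt hcard
    have hmk : Cardinal.mk (Vset β) = Cardinal.lift.{1, 0} (Cardinal.preBeth β) := by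
      rw [← card_vonNeumann, ← cardinalMk_coe_sort]
      exact Cardinal.mk_congr (Equiv.subtypeEquivRight fun x => mem_vonNeumann.symm)
    obtain ⟨c, rfl⟩ := hκ
    have hc : Cardinal.aleph0 ≤ c := by
      rw [← Cardinal.ord_le_ord, Cardinal.ord_aleph0]
      exact hω.le
    rw [hmk, Cardinal.lift_lt, Cardinal.beth_eq_preBeth,
      (Ordinal.isPrincipal_add_ord hc).add_eq_right hω] at hlt
    exact Cardinal.preBeth_strictMono.lt_iff_lt.1 hlt
  have hp : ∀ i < 8, _ := fun i hi => hp1 (true, i) (by simp [free_noGoodF, hi]) rfl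
  exact not_noGood_of_collapse hωα.le hβ hlam (hp 1 (by decide)) (hp 2 (by decide))
    (hp 3 (by decide)) hπ hπN (eval_noGoodF.1 hev)

/- STATEMENT 13.  A cardinal `κ` is supercompact if and only if `V_κ` satisfies the
two-sorted reflection principle above. -/
theorem statement13 (κ : Ordinal) (hκ : ∃ c : Cardinal, c.ord = κ) :
    Supercompact κ ↔ TwoSortedReflection κ := by
  exact ⟨Supercompact.twoSortedReflection, TwoSortedReflection.supercompact hκ⟩
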